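/- arXiv:1503.04826 — 3 statements merged into one kernel-verified Lean document; each statement's English description precedes it below -/
import Mathlib

section
/- Fix d ≥ 3 and an exponent p with 2−d ≤ p < 0, and let K^r(x) = −|x|^p/p (so K^r ≥ 0, K^r(0) = +∞). Let ψ_ε be the heat kernel and set K^r_ε := ψ_ε * K^r * ψ_ε. Then for every x ∈ ℝ^d the map ε ↦ K^r_ε(x) is nonincreasing on (0,∞): for all 0 < ε₂ ≤ ε₁, K^r_{ε₁}(x) ≤ K^r_{ε₂}(x). -/
open MeasureTheory Filter
open scoped ENNReal Topology NNReal

noncomputable section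

/-- Power-law interaction kernel `K(x) = |x|^q/q - |x|^p/p` (real-valued). -/
noncomputable def Kfun (d : ℕ) (p q : ℝ) (x : EuclideanSpace ℝ (Fin d)) : ℝ :=
  ‖x‖ ^ q / q - ‖x‖ ^ p / p

/-- Power-law interaction kernel, valued in `[0,∞]` (note `K 0 = ∞` when `p < 0 < q`). -/
noncomputable def KE (d : ℕ) (p q : ℝ) (x : EuclideanSpace ℝ (Fin d)) : ℝ≥0∞ :=
  (‖x‖₊ : ℝ≥0∞) ^ q / ENNReal.ofReal q + (‖x‖₊ : ℝ≥0∞) ^ p / ENNReal.ofReal (-p)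

/-- Repulsive part `K^r(x) = -|x|^p/p` of the power-law kernel, valued in `[0,∞]`. -/
noncomputable def KrE (d : ℕ) (p : ℝ) (x : EuclideanSpace ℝ (Fin d)) : ℝ≥0∞ :=
  (‖x‖₊ : ℝ≥0∞) ^ p / ENNReal.ofReal (-p)

/-- Rescaled mollifier `φ_ε(x) = ε^{-d} φ(x/ε)`. -/
noncomputable def scaled (d : ℕ) (φ : EuclideanSpace ℝ (Fin d) → ℝ) (ε : ℝ)
    (x : EuclideanSpace ℝ (Fin d)) : ℝ :=
  (ε ^ d)⁻¹ * φ (ε⁻¹ • x)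

/-- Mollifier hypotheses (M1)–(M3). -/
def IsMollifier (d : ℕ) (φ : EuclideanSpace ℝ (Fin d) → ℝ) : Prop :=
  ContDiff ℝ (⊤ : ℕ∞) φ ∧ (∀ x y, ‖x‖ = ‖y‖ → φ x = φ y) ∧ (∀ x, 0 ≤ φ x) ∧
    (∫ x, φ x) = 1 ∧
    ∃ C : ℝ, 0 < C ∧ ∃ l : ℝ, max (2 * (d : ℝ) + 1) 4 ≤ l ∧
      ∀ x : EuclideanSpace ℝ (Fin d), x ≠ 0 → φ x ≤ C * ‖x‖ ^ (-l)

/-- Regularized kernel `K_ε = φ_ε * K * φ_ε` (real-valued). -/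
noncomputable def Kreg (d : ℕ) (p q : ℝ) (φ : EuclideanSpace ℝ (Fin d) → ℝ) (ε : ℝ)
    (x : EuclideanSpace ℝ (Fin d)) : ℝ :=
  ∫ y, ∫ z, scaled d φ ε y * Kfun d p q (x - y - z) * scaled d φ ε z

/-- Double mollification `g * K * g` of a `[0,∞]`-valued kernel by a nonnegative function. -/
noncomputable def convE (d : ℕ) (g : EuclideanSpace ℝ (Fin d) → ℝ)
    (K : EuclideanSpace ℝ (Fin d) → ℝ≥0∞) (x : EuclideanSpace ℝ (Fin d)) : ℝ≥0∞ :=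
  ∫⁻ y, ∫⁻ z, ENNReal.ofReal (g y) * K (x - y - z) * ENNReal.ofReal (g z)

/-- Interaction energy `E(μ) = ∬ K(x-y) dμ(x) dμ(y)` for a `[0,∞]`-valued kernel. -/
noncomputable def energyE (d : ℕ) (K : EuclideanSpace ℝ (Fin d) → ℝ≥0∞)
    (μ : Measure (EuclideanSpace ℝ (Fin d))) : ℝ≥0∞ :=
  ∫⁻ x, ∫⁻ y, K (x - y) ∂μ ∂μ

/-- Regularized interaction energy `E_ε(μ) = ∬ K_ε(x-y) dμ(x) dμ(y)`. -/
noncomputable def energyReg (d : ℕ) (p q : ℝ) (φ : EuclideanSpace ℝ (Fin d) → ℝ) (ε : ℝ)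
    (μ : Measure (EuclideanSpace ℝ (Fin d))) : ℝ≥0∞ :=
  energyE d (fun x => ENNReal.ofReal (Kreg d p q φ ε x)) μ

/-- Real-valued interaction energy. -/
noncomputable def energyReal (d : ℕ) (p q : ℝ) (μ : Measure (EuclideanSpace ℝ (Fin d))) : ℝ :=
  ∫ x, ∫ y, Kfun d p q (x - y) ∂μ ∂μ

/-- Borel probability measure with finite second moment. -/
def IsP2 (d : ℕ) (μ : Measure (EuclideanSpace ℝ (Fin d))) : Prop :=
  IsProbabilityMeasure μ ∧ (∫⁻ x, (‖x‖₊ : ℝ≥0∞) ^ 2 ∂μ) < ⊤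

/-- The heat kernel `ψ_ε(x) = (4πε)^{-d/2} e^{-|x|²/(4ε)}`. -/
noncomputable def heat (d : ℕ) (ε : ℝ) (x : EuclideanSpace ℝ (Fin d)) : ℝ :=
  (4 * Real.pi * ε) ^ (-(d : ℝ) / 2) * Real.exp (-‖x‖ ^ 2 / (4 * ε))

/-- Weak-* convergence of a sequence of measures: convergence of integrals of all bounded
continuous functions. -/
def WeakStarTendsto (d : ℕ) (μ : ℕ → Measure (EuclideanSpace ℝ (Fin d)))
    (ν : Measure (EuclideanSpace ℝ (Fin d))) : Prop :=
  ∀ f : EuclideanSpace ℝ (Fin d) → ℝ, Continuous f → (∃ M : ℝ, ∀ x, |f x| ≤ M) →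
    Tendsto (fun k => ∫ x, f x ∂(μ k)) atTop (𝓝 (∫ x, f x ∂ν))

/-- `μ` is absolutely continuous (w.r.t. Lebesgue) with density bounded by `R`. -/
def HasBddDensity (d : ℕ) (μ : Measure (EuclideanSpace ℝ (Fin d))) (R : ℝ) : Prop :=
  ∃ ρ : EuclideanSpace ℝ (Fin d) → ℝ≥0∞, Measurable ρ ∧ μ = volume.withDensity ρ ∧
    ∀ᵐ x ∂(volume : Measure (EuclideanSpace ℝ (Fin d))), ρ x ≤ ENNReal.ofReal R

/-- Explicit gradient `∇K(x) = x|x|^{q-2} - x|x|^{p-2}` of the power-law kernel. -/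
noncomputable def gradK (d : ℕ) (p q : ℝ) (x : EuclideanSpace ℝ (Fin d)) :
    EuclideanSpace ℝ (Fin d) :=
  (‖x‖ ^ (q - 2)) • x - (‖x‖ ^ (p - 2)) • x

/-- The log-Lipschitz modulus of convexity `ω`. -/
noncomputable def omegaMod (x : ℝ) : ℝ :=
  if x ≤ Real.exp (-1 - Real.sqrt 2) then x * |Real.log x|
  else Real.sqrt (x ^ 2 + 2 * (1 + Real.sqrt 2) * Real.exp (-1 - Real.sqrt 2) * x)

/-- Support of a measure: points all of whose neighborhoods have positive measure. -/
def msupport (d : ℕ) (μ : Measure (EuclideanSpace ℝ (Fin d))) :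
    Set (EuclideanSpace ℝ (Fin d)) :=
  {x | ∀ r : ℝ, 0 < r → 0 < μ (Metric.ball x r)}

/-- The measure `μ * ψ_δ` obtained by mollifying `μ` with the heat kernel at scale `δ`. -/
noncomputable def heatMollified (d : ℕ) (μ : Measure (EuclideanSpace ℝ (Fin d))) (δ : ℝ) :
    Measure (EuclideanSpace ℝ (Fin d)) :=
  volume.withDensity fun x => ENNReal.ofReal (∫ y, heat d δ (x - y) ∂μ)
lemma heat_semigroup_real (d : ℕ) (s t : ℝ) (hs : 0 < s) (ht : 0 < t)
    (w z : EuclideanSpace ℝ (Fin d)) :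
    heat d s (w - z) * heat d t z =
      ((4 * Real.pi * s) ^ (-(d : ℝ) / 2) * (4 * Real.pi * t) ^ (-(d : ℝ) / 2) *
        Real.exp (-‖w‖ ^ 2 / (4 * (s + t)))) *
        Real.exp (-((s + t) / (4 * s * t)) * ‖z - (t / (s + t)) • w‖ ^ 2) := by
  unfold heat
  have h : Real.exp (-‖w - z‖ ^ 2 / (4 * s)) * Real.exp (-‖z‖ ^ 2 / (4 * t)) =
      Real.exp (-‖w‖ ^ 2 / (4 * (s + t))) *
        Real.exp (-((s + t) / (4 * s * t)) * ‖z - (t / (s + t)) • w‖ ^ 2) := by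
    rw [← Real.exp_add, ← Real.exp_add]
    congr 1
    rw [norm_sub_sq_real, norm_sub_sq_real, inner_smul_right, norm_smul, real_inner_comm,
      Real.norm_eq_abs, mul_pow, sq_abs]
    have : s + t ≠ 0 := by positivity
    field_simp
    ring
  linear_combination ((4 * Real.pi * s) ^ (-(d : ℝ) / 2) *
    (4 * Real.pi * t) ^ (-(d : ℝ) / 2)) * h

lemma heat_nonneg' (d : ℕ) (s : ℝ) (hs : 0 < s) (w : EuclideanSpace ℝ (Fin d)) :
    0 ≤ heat d s w := by
  unfold heat; positivity

lemma heat_semigroup (d : ℕ) (s t : ℝ) (hs : 0 < s) (ht : 0 < t)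
    (w : EuclideanSpace ℝ (Fin d)) :
    ∫⁻ z, ENNReal.ofReal (heat d s (w - z)) * ENNReal.ofReal (heat d t z) =
      ENNReal.ofReal (heat d (s + t) w) := by
  have hb : 0 < (s + t) / (4 * s * t) := by positivity
  have hval := GaussianFourier.integral_rexp_neg_mul_sq_norm
    (V := EuclideanSpace ℝ (Fin d)) hb
  have hint : Integrable (fun v : EuclideanSpace ℝ (Fin d) =>
      Real.exp (-((s + t) / (4 * s * t)) * ‖v‖ ^ 2)) := by
    by_contra hcon
    rw [integral_undef hcon] at hval
    have : 0 < (Real.pi / ((s + t) / (4 * s * t))) ^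
      (Module.finrank ℝ (EuclideanSpace ℝ (Fin d)) / 2 : ℝ) := by positivity
    linarith
  simp_rw [← ENNReal.ofReal_mul (heat_nonneg' d s hs _), heat_semigroup_real d s t hs ht]
  rw [← ofReal_integral_eq_lintegral_ofReal]
  · congr 1
    rw [integral_const_mul, integral_sub_right_eq_self (fun v : EuclideanSpace ℝ (Fin d) =>
      Real.exp (-((s + t) / (4 * s * t)) * ‖v‖ ^ 2)), hval]
    unfold heat
    rw [finrank_euclideanSpace_fin]
    have e : (4 * Real.pi * s) ^ (-(d : ℝ) / 2) * (4 * Real.pi * t) ^ (-(d : ℝ) / 2) *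
        (Real.pi / ((s + t) / (4 * s * t))) ^ ((d : ℝ) / 2) =
        (4 * Real.pi * (s + t)) ^ (-(d : ℝ) / 2) := by
      have : (Real.pi / ((s + t) / (4 * s * t))) ^ ((d : ℝ) / 2) =
        ((Real.pi / ((s + t) / (4 * s * t)))⁻¹) ^ (-(d : ℝ) / 2) := by
        rw [Real.inv_rpow (by positivity), ← Real.rpow_neg (by positivity)]
        congr 1; ring
      rw [this, ← Real.mul_rpow (by positivity) (by positivity),
        ← Real.mul_rpow (by positivity) (by positivity)]
      congr 1
      have : s + t ≠ 0 := by positivity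
      have := Real.pi_ne_zero
      field_simp
    rw [← e]; ring
  · exact (hint.comp_sub_right _).const_mul _
  · exact Filter.Eventually.of_forall fun z => by positivity

lemma KrE_subord (d : ℕ) (p : ℝ) (hp2 : p < 0) :
    ∃ c : ℝ≥0∞, ∀ w : EuclideanSpace ℝ (Fin d), w ≠ 0 →
      KrE d p w = c * ∫⁻ s in Set.Ioi (0 : ℝ),
        ENNReal.ofReal (s ^ (((d : ℝ) + p) / 2 - 1)) * ENNReal.ofReal (heat d s w) := by
  set C : ℝ := (4 * Real.pi) ^ (-(d : ℝ) / 2) * (4 : ℝ) ^ (-p / 2) * Real.Gamma (-p / 2) with hC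
  have hG : 0 < Real.Gamma (-p / 2) := Real.Gamma_pos_of_pos (by linarith)
  have hCpos : 0 < C := by positivity
  refine ⟨ENNReal.ofReal (C⁻¹ / (-p)), fun w hw => ?_⟩
  have hw' : 0 < ‖w‖ := norm_pos_iff.mpr hw
  have hr : 0 < ‖w‖ ^ 2 / 4 := by positivity
  have hval := Real.integral_rpow_mul_exp_neg_mul_Ioi (a := -p / 2) (r := ‖w‖ ^ 2 / 4)
    (by linarith) hr
  have hpos : 0 < (1 / (‖w‖ ^ 2 / 4)) ^ (-p / 2) * Real.Gamma (-p / 2) := by positivity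
  have hint : IntegrableOn (fun t : ℝ => t ^ (-p / 2 - 1) * Real.exp (-(‖w‖ ^ 2 / 4 * t)))
      (Set.Ioi 0) := by
    by_contra hcon
    rw [integral_undef hcon] at hval
    linarith
  have hint2 := (integrableOn_Ioi_comp_rpow_iff _ (p := -1) (by norm_num)).mpr hint
  have hval2 := integral_comp_rpow_Ioi
    (fun t : ℝ => t ^ (-p / 2 - 1) * Real.exp (-(‖w‖ ^ 2 / 4 * t))) (p := -1) (by norm_num)
  rw [hval] at hval2
  have hEq : ∀ s ∈ Set.Ioi (0 : ℝ),
      ENNReal.ofReal (s ^ (((d : ℝ) + p) / 2 - 1)) * ENNReal.ofReal (heat d s w) =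
      ENNReal.ofReal ((4 * Real.pi) ^ (-(d : ℝ) / 2) * ((|(-1 : ℝ)| * s ^ ((-1 : ℝ) - 1)) •
        ((s ^ (-1 : ℝ)) ^ (-p / 2 - 1) * Real.exp (-(‖w‖ ^ 2 / 4 * s ^ (-1 : ℝ)))))) := by
    intro s hs
    have hs : 0 < s := hs
    rw [← ENNReal.ofReal_mul (by positivity)]
    congr 1
    unfold heat
    rw [Real.mul_rpow (by positivity) hs.le, ← Real.rpow_mul hs.le, abs_neg, abs_one, one_mul,
      smul_eq_mul]
    have e1 : s ^ (((d : ℝ) + p) / 2 - 1) * s ^ (-(d : ℝ) / 2) =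
        s ^ ((-1 : ℝ) - 1) * s ^ (-1 * (-p / 2 - 1)) := by
      rw [← Real.rpow_add hs, ← Real.rpow_add hs]; congr 1; ring
    have e2 : -‖w‖ ^ 2 / (4 * s) = -(‖w‖ ^ 2 / 4 * s ^ (-1 : ℝ)) := by
      rw [Real.rpow_neg_one]; field_simp
    rw [e2]
    linear_combination (4 * Real.pi) ^ (-(d : ℝ) / 2) *
      Real.exp (-(‖w‖ ^ 2 / 4 * s ^ (-1 : ℝ))) * e1
  rw [setLIntegral_congr_fun measurableSet_Ioi hEq, ← ofReal_integral_eq_lintegral_ofReal]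
  · rw [integral_const_mul, hval2, ← ENNReal.ofReal_mul
      (div_nonneg (by positivity) (by linarith))]
    unfold KrE
    have hn : (‖w‖₊ : ℝ≥0∞) = ENNReal.ofReal ‖w‖ := by
      rw [ofReal_norm]; rfl
    rw [hn, ENNReal.ofReal_rpow_of_pos hw', ← ENNReal.ofReal_div_of_pos (by linarith)]
    congr 1
    have e3 : (1 / (‖w‖ ^ 2 / 4)) ^ (-p / 2) = (4 : ℝ) ^ (-p / 2) * ‖w‖ ^ p := by
      rw [one_div_div, Real.div_rpow (by norm_num) (by positivity), div_eq_mul_inv,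
        ← Real.rpow_neg (by positivity), ← Real.rpow_natCast, ← Real.rpow_mul hw'.le]
      congr 2; push_cast; ring
    rw [e3]
    have : C⁻¹ * C = 1 := inv_mul_cancel₀ hCpos.ne'
    have e4 : C⁻¹ / -p * ((4 * Real.pi) ^ (-(d : ℝ) / 2) *
        ((4 : ℝ) ^ (-p / 2) * ‖w‖ ^ p * Real.Gamma (-p / 2))) = (C⁻¹ * C) * ‖w‖ ^ p / -p := by
      rw [hC]; ring
    rw [e4, this, one_mul]
  · exact hint2.const_mul _
  · filter_upwards [ae_restrict_mem measurableSet_Ioi] with s hs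
    have hs : 0 < s := hs
    simp only [smul_eq_mul, Pi.zero_apply]
    positivity

lemma measurable_heat' (d : ℕ) :
    Measurable (fun q : ℝ × EuclideanSpace ℝ (Fin d) => heat d q.1 q.2) := by
  unfold heat
  fun_prop

lemma heat_conv_step (d : ℕ) (β δ ε : ℝ) (hδ : 0 ≤ δ) (hε : 0 < ε)
    (w : EuclideanSpace ℝ (Fin d)) :
    ∫⁻ z, (∫⁻ s in Set.Ioi (0 : ℝ), ENNReal.ofReal (s ^ β) *
      ENNReal.ofReal (heat d (s + δ) (w - z))) * ENNReal.ofReal (heat d ε z) =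
    ∫⁻ s in Set.Ioi (0 : ℝ), ENNReal.ofReal (s ^ β) *
      ENNReal.ofReal (heat d (s + δ + ε) w) := by
  have hH := measurable_heat' d
  have m1 : Measurable (fun q : EuclideanSpace ℝ (Fin d) × ℝ =>
      heat d (q.2 + δ) (w - q.1)) :=
    hH.comp (f := fun q : EuclideanSpace ℝ (Fin d) × ℝ => (q.2 + δ, w - q.1)) (by fun_prop)
  have m2 : Measurable (fun z : EuclideanSpace ℝ (Fin d) => heat d ε z) :=
    hH.comp (f := fun z : EuclideanSpace ℝ (Fin d) => (ε, z)) (by fun_prop)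
  have m3 : Measurable (fun q : EuclideanSpace ℝ (Fin d) × ℝ =>
      ENNReal.ofReal (q.2 ^ β) * ENNReal.ofReal (heat d (q.2 + δ) (w - q.1))) :=
    (by fun_prop : Measurable (fun q : EuclideanSpace ℝ (Fin d) × ℝ =>
      ENNReal.ofReal (q.2 ^ β))).mul m1.ennreal_ofReal
  have h1 : ∀ z : EuclideanSpace ℝ (Fin d), (∫⁻ s in Set.Ioi (0 : ℝ), ENNReal.ofReal (s ^ β) *
      ENNReal.ofReal (heat d (s + δ) (w - z))) * ENNReal.ofReal (heat d ε z) =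
      ∫⁻ s in Set.Ioi (0 : ℝ), ENNReal.ofReal (s ^ β) *
      ENNReal.ofReal (heat d (s + δ) (w - z)) * ENNReal.ofReal (heat d ε z) := fun z =>
    (lintegral_mul_const _ (m3.comp (measurable_prodMk_left (x := z)))).symm
  simp_rw [h1]
  rw [lintegral_lintegral_swap]
  · refine setLIntegral_congr_fun measurableSet_Ioi fun s hs => ?_
    have hs : 0 < s := hs
    simp only [mul_assoc]
    rw [lintegral_const_mul', heat_semigroup d (s + δ) ε (by linarith) hε]
    exact ENNReal.ofReal_ne_top
  · exact (m3.mul (m2.comp measurable_fst).ennreal_ofReal).aemeasurable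

lemma convE_heat (d : ℕ) (hd : 3 ≤ d) (p : ℝ) (c : ℝ≥0∞)
    (hc : ∀ w : EuclideanSpace ℝ (Fin d), w ≠ 0 →
      KrE d p w = c * ∫⁻ s in Set.Ioi (0 : ℝ),
        ENNReal.ofReal (s ^ (((d : ℝ) + p) / 2 - 1)) * ENNReal.ofReal (heat d s w))
    (x : EuclideanSpace ℝ (Fin d)) (ε : ℝ) (hε : 0 < ε) :
    convE d (heat d ε) (KrE d p) x = c * ∫⁻ s in Set.Ioi (0 : ℝ),
        ENNReal.ofReal (s ^ (((d : ℝ) + p) / 2 - 1)) *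
          ENNReal.ofReal (heat d (s + ε + ε) x) := by
  have : Nonempty (Fin d) := ⟨⟨0, by omega⟩⟩
  have hH := measurable_heat' d
  have m2 : Measurable (fun z : EuclideanSpace ℝ (Fin d) => heat d ε z) :=
    hH.comp (f := fun z : EuclideanSpace ℝ (Fin d) => (ε, z)) (by fun_prop)
  have mm : ∀ δ : ℝ, ∀ v : EuclideanSpace ℝ (Fin d),
      Measurable (fun y : EuclideanSpace ℝ (Fin d) => ∫⁻ s in Set.Ioi (0 : ℝ),
        ENNReal.ofReal (s ^ (((d : ℝ) + p) / 2 - 1)) *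
          ENNReal.ofReal (heat d (s + δ) (v - y))) := by
    intro δ v
    apply Measurable.lintegral_prod_right'
      (f := fun q : EuclideanSpace ℝ (Fin d) × ℝ =>
        ENNReal.ofReal (q.2 ^ (((d : ℝ) + p) / 2 - 1)) *
          ENNReal.ofReal (heat d (q.2 + δ) (v - q.1)))
    refine Measurable.mul (by fun_prop) (Measurable.ennreal_ofReal ?_)
    exact hH.comp (f := fun q : EuclideanSpace ℝ (Fin d) × ℝ => (q.2 + δ, v - q.1))
      (by fun_prop)
  unfold convE
  have inner : ∀ y : EuclideanSpace ℝ (Fin d),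
      ∫⁻ z, ENNReal.ofReal (heat d ε y) * KrE d p (x - y - z) * ENNReal.ofReal (heat d ε z) =
      c * ((∫⁻ s in Set.Ioi (0 : ℝ), ENNReal.ofReal (s ^ (((d : ℝ) + p) / 2 - 1)) *
          ENNReal.ofReal (heat d (s + ε) (x - y))) * ENNReal.ofReal (heat d ε y)) := by
    intro y
    have hst := heat_conv_step d (((d : ℝ) + p) / 2 - 1) 0 ε le_rfl hε (x - y)
    have m0 := mm 0 (x - y)
    simp only [add_zero] at hst m0
    have m0' : Measurable (fun z : EuclideanSpace ℝ (Fin d) =>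
        (∫⁻ s in Set.Ioi (0 : ℝ), ENNReal.ofReal (s ^ (((d : ℝ) + p) / 2 - 1)) *
          ENNReal.ofReal (heat d s (x - y - z))) * ENNReal.ofReal (heat d ε z)) :=
      m0.mul m2.ennreal_ofReal
    rw [← hst, mul_comm _ (ENNReal.ofReal (heat d ε y)), ← mul_assoc,
      ← lintegral_const_mul _ m0']
    apply lintegral_congr_ae
    have hne : ∀ᵐ z : EuclideanSpace ℝ (Fin d), z ≠ x - y := by
      rw [ae_iff]; simp
    filter_upwards [hne] with z hz
    rw [hc _ (sub_ne_zero.mpr (Ne.symm hz))]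
    ring
  simp_rw [inner]
  have m4 : Measurable (fun y : EuclideanSpace ℝ (Fin d) =>
      (∫⁻ s in Set.Ioi (0 : ℝ), ENNReal.ofReal (s ^ (((d : ℝ) + p) / 2 - 1)) *
        ENNReal.ofReal (heat d (s + ε) (x - y))) * ENNReal.ofReal (heat d ε y)) :=
    (mm ε x).mul m2.ennreal_ofReal
  rw [lintegral_const_mul _ m4,
    heat_conv_step d _ ε ε hε.le hε x]

/-- Monotonicity in `ε` of the heat-kernel regularization of the repulsive
power-law kernel. -/
theorem heat_regularized_repulsive_kernel_antitone
    (d : ℕ) (hd : 3 ≤ d) (p : ℝ) (hp1 : 2 - (d : ℝ) ≤ p) (hp2 : p < 0)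
    (x : EuclideanSpace ℝ (Fin d)) (ε₁ ε₂ : ℝ) (hε₂ : 0 < ε₂) (hε : ε₂ ≤ ε₁) :
    convE d (heat d ε₁) (KrE d p) x ≤ convE d (heat d ε₂) (KrE d p) x := by
  obtain ⟨c, hc⟩ := KrE_subord d p hp2
  rw [convE_heat d hd p c hc x ε₁ (by linarith), convE_heat d hd p c hc x ε₂ hε₂]
  refine mul_le_mul_right ?_ _
  rw [← lintegral_indicator measurableSet_Ioi, ← lintegral_indicator measurableSet_Ioi]
  conv_rhs => rw [← lintegral_add_right_eq_self (μ := (volume : Measure ℝ)) _ (2 * (ε₁ - ε₂))]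
  refine lintegral_mono fun s => ?_
  by_cases hs : 0 < s
  · have hs' : 0 < s + 2 * (ε₁ - ε₂) := by linarith
    rw [Set.indicator_of_mem (Set.mem_Ioi.mpr hs), Set.indicator_of_mem (Set.mem_Ioi.mpr hs')]
    have e : s + 2 * (ε₁ - ε₂) + ε₂ + ε₂ = s + ε₁ + ε₁ := by ring
    rw [e]
    gcongr
    · linarith
    · linarith
  · rw [Set.indicator_of_notMem (by simpa using hs)]
    exact zero_le
end
end

section
/- There exist a constant C_φ > 0 and ε₀ > 0 such that for every 0 < ε < ε₀, both functions x ↦ K_ε(x) + (C_φ ε^{−d}/2)|x|² and x ↦ −K_ε(x) + (C_φ ε^{−d}/2)|x|² are convex on ℝ^d; i.e., K_ε and −K_ε are λ_ε-convex with λ_ε = −C_φ ε^{−d}. -/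
open MeasureTheory Filter
open scoped ENNReal Topology NNReal

noncomputable section

lemma aux_exp1 (θ : ℝ) : ‖Complex.exp (θ * Complex.I) - 1 - θ * Complex.I‖ ≤ 2 * θ ^ 2 := by
  have hn : ‖(θ : ℂ) * Complex.I‖ = |θ| := by simp
  rcases le_or_gt |θ| 1 with h | h
  · have := Complex.norm_exp_sub_one_sub_id_le (x := θ * Complex.I) (by rw [hn]; exact h)
    rw [hn, sq_abs] at this
    nlinarith [sq_nonneg θ]
  · have h1 : ‖Complex.exp (θ * Complex.I) - 1‖ ≤ |θ| := by
      have := Real.norm_exp_I_mul_ofReal_sub_one_le (x := θ)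
      rwa [mul_comm, Real.norm_eq_abs] at this
    have h2 := norm_sub_le (Complex.exp (θ * Complex.I) - 1) (θ * Complex.I)
    rw [hn] at h2
    have : θ ^ 2 = |θ| ^ 2 := (sq_abs θ).symm
    nlinarith

lemma aux_exp_defect (a b α β : ℝ) (ha : 0 ≤ a) (hb : 0 ≤ b) (hab : a + b = 1) :
    ‖(a : ℂ) * Complex.exp (α * Complex.I) + b * Complex.exp (β * Complex.I)
      - Complex.exp ((a * α + b * β : ℝ) * Complex.I)‖ ≤ 2 * (a * b) * (α - β) ^ 2 := by
  have hb' : b = 1 - a := by linarith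
  set m : ℝ := a * α + b * β with hm
  have e1 : Complex.exp (α * Complex.I) =
      Complex.exp (m * Complex.I) * Complex.exp ((b * (α - β) : ℝ) * Complex.I) := by
    rw [← Complex.exp_add]; congr 1; rw [hm, hb']; push_cast; ring
  have e2 : Complex.exp (β * Complex.I) =
      Complex.exp (m * Complex.I) * Complex.exp ((-(a * (α - β)) : ℝ) * Complex.I) := by
    rw [← Complex.exp_add]; congr 1; rw [hm, hb']; push_cast; ring
  have e3 : (a : ℂ) * Complex.exp (α * Complex.I) + b * Complex.exp (β * Complex.I)
      - Complex.exp (m * Complex.I) = Complex.exp (m * Complex.I) *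
      (a * (Complex.exp ((b * (α - β) : ℝ) * Complex.I) - 1 - (b * (α - β) : ℝ) * Complex.I)
      + b * (Complex.exp ((-(a * (α - β)) : ℝ) * Complex.I) - 1
        - (-(a * (α - β)) : ℝ) * Complex.I)) := by
    rw [e1, e2, hb']; push_cast; ring
  rw [e3, norm_mul, Complex.norm_exp_ofReal_mul_I, one_mul]
  refine (norm_add_le _ _).trans ?_
  rw [norm_mul, norm_mul, Complex.norm_real, Complex.norm_real, Real.norm_of_nonneg ha,
    Real.norm_of_nonneg hb]
  have h1 := mul_le_mul_of_nonneg_left (aux_exp1 (b * (α - β))) ha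
  have h2 := mul_le_mul_of_nonneg_left (aux_exp1 (-(a * (α - β)))) hb
  refine (add_le_add h1 h2).trans (le_of_eq ?_)
  rw [hb']; ring

lemma aux_ball (d : ℕ) (hd : 1 ≤ d) (s : ℝ) (hs : -(d : ℝ) < s) :
    IntegrableOn (fun x : EuclideanSpace ℝ (Fin d) => ‖x‖ ^ s) (Metric.ball 0 1) := by
  have : Nonempty (Fin d) := ⟨⟨0, hd⟩⟩
  rw [integrableOn_fun_norm_addHaar volume (f := fun r : ℝ => r ^ s)]
  simp only [finrank_euclideanSpace, Fintype.card_fin, smul_eq_mul]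
  have : IntegrableOn (fun y : ℝ => y ^ (s + d - 1)) (Set.Ioo 0 1) := by
    rw [← intervalIntegrable_iff_integrableOn_Ioo_of_le zero_le_one]
    exact intervalIntegral.intervalIntegrable_rpow' (by linarith)
  refine this.congr_fun (fun y hy => ?_) measurableSet_Ioo
  have : ((d - 1 : ℕ) : ℝ) = d - 1 := by push_cast [Nat.cast_sub hd]; ring
  dsimp only
  rw [← Real.rpow_natCast, ← Real.rpow_add hy.1, this]
  congr 1; ring

lemma aux_rep_neg (s r : ℝ) (hs : s < 0) (hr : 0 < r) :
    IntegrableOn (fun t : ℝ => t ^ (-s / 2 - 1) * Real.exp (-(t * r ^ 2))) (Set.Ioi 0) ∧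
    ∫ t in Set.Ioi 0, t ^ (-s / 2 - 1) * Real.exp (-(t * r ^ 2)) = Real.Gamma (-s / 2) * r ^ s := by
  have h0 : 0 < -s / 2 := by linarith
  have hr2 : 0 < r ^ 2 := by positivity
  constructor
  · have := integrableOn_rpow_mul_exp_neg_mul_rpow (p := 1) (s := -s / 2 - 1) (b := r ^ 2)
      (by linarith) one_pos hr2
    refine this.congr_fun (fun t ht => ?_) measurableSet_Ioi
    dsimp only
    rw [Real.rpow_one]; congr 2; ring
  · have := Real.integral_rpow_mul_exp_neg_mul_Ioi h0 hr2
    simp_rw [mul_comm _ (r ^ 2)]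
    rw [this, mul_comm]; congr 1
    rw [one_div, ← Real.rpow_natCast, ← Real.rpow_neg hr.le, ← Real.rpow_mul hr.le]
    congr 1; push_cast; ring

lemma aux_G (s : ℝ) (hs : 0 < s) (hs2 : s < 2) :
    IntegrableOn (fun t : ℝ => t ^ (-s / 2 - 1) * (1 - Real.exp (-t))) (Set.Ioi 0) ∧
    0 < ∫ t in Set.Ioi 0, t ^ (-s / 2 - 1) * (1 - Real.exp (-t)) := by
  have hm : Measurable (fun t : ℝ => t ^ (-s / 2 - 1) * (1 - Real.exp (-t))) := by fun_prop
  have hI : IntegrableOn (fun t : ℝ => t ^ (-s / 2 - 1) * (1 - Real.exp (-t))) (Set.Ioi 0) := by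
    rw [← Set.Ioc_union_Ioi_eq_Ioi (zero_le_one (α := ℝ))]
    refine IntegrableOn.union ?_ ?_
    · have h1 : IntegrableOn (fun t : ℝ => t ^ (-s / 2)) (Set.Ioc 0 1) := by
        rw [← intervalIntegrable_iff_integrableOn_Ioc_of_le zero_le_one]
        exact intervalIntegral.intervalIntegrable_rpow' (by linarith)
      refine Integrable.mono' h1 hm.aestronglyMeasurable ?_
      filter_upwards [ae_restrict_mem measurableSet_Ioc] with t ht
      have e1 : 1 - Real.exp (-t) ≤ t := by linarith [Real.add_one_le_exp (-t)]
      have e2 : 0 ≤ 1 - Real.exp (-t) := by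
        have := Real.exp_le_one_iff.2 (neg_nonpos.2 ht.1.le); linarith
      have e3 : 0 ≤ t ^ (-s / 2 - 1) := Real.rpow_nonneg ht.1.le _
      rw [Real.norm_of_nonneg (mul_nonneg e3 e2)]
      refine (mul_le_mul_of_nonneg_left e1 e3).trans (le_of_eq ?_)
      rw [Real.rpow_sub_one ht.1.ne']; field_simp [ht.1.ne']
    · have h1 : IntegrableOn (fun t : ℝ => t ^ (-s / 2 - 1)) (Set.Ioi 1) :=
        integrableOn_Ioi_rpow_of_lt (by linarith) one_pos
      refine Integrable.mono' h1 hm.aestronglyMeasurable ?_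
      filter_upwards [ae_restrict_mem measurableSet_Ioi] with t ht
      have ht0 : 0 < t := one_pos.trans ht
      have e1 : 1 - Real.exp (-t) ≤ 1 := by linarith [Real.exp_pos (-t)]
      have e2 : 0 ≤ 1 - Real.exp (-t) := by
        have := Real.exp_le_one_iff.2 (neg_nonpos.2 ht0.le); linarith
      have e3 : 0 ≤ t ^ (-s / 2 - 1) := Real.rpow_nonneg ht0.le _
      rw [Real.norm_of_nonneg (mul_nonneg e3 e2)]
      exact (mul_le_mul_of_nonneg_left e1 e3).trans (by simp)
  refine ⟨hI, ?_⟩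
  have hpos : ∀ t ∈ Set.Ioi (0 : ℝ), 0 < t ^ (-s / 2 - 1) * (1 - Real.exp (-t)) := by
    intro t ht
    have : Real.exp (-t) < 1 := Real.exp_lt_one_iff.2 (neg_lt_zero.2 ht)
    exact mul_pos (Real.rpow_pos_of_pos ht _) (by linarith)
  rw [setIntegral_pos_iff_support_of_nonneg_ae _ hI]
  · have hsub : Set.Ioi (0 : ℝ) ⊆
        Function.support (fun t : ℝ => t ^ (-s / 2 - 1) * (1 - Real.exp (-t))) :=
      fun t ht => (hpos t ht).ne'
    rw [Set.inter_eq_self_of_subset_right hsub]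
    simp
  · filter_upwards [ae_restrict_mem measurableSet_Ioi] with t ht using (hpos t ht).le

lemma aux_rep_pos (s r : ℝ) (hs : 0 < s) (hs2 : s < 2) (hr : 0 < r) :
    IntegrableOn (fun t : ℝ => t ^ (-s / 2 - 1) * (1 - Real.exp (-(t * r ^ 2)))) (Set.Ioi 0) ∧
    ∫ t in Set.Ioi 0, t ^ (-s / 2 - 1) * (1 - Real.exp (-(t * r ^ 2))) =
      (∫ t in Set.Ioi 0, t ^ (-s / 2 - 1) * (1 - Real.exp (-t))) * r ^ s := by
  have hr2 : 0 < r ^ 2 := by positivity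
  have key : Set.EqOn (fun t : ℝ => (r ^ 2) ^ (s / 2 + 1) *
      ((r ^ 2 * t) ^ (-s / 2 - 1) * (1 - Real.exp (-(r ^ 2 * t)))))
      (fun t : ℝ => t ^ (-s / 2 - 1) * (1 - Real.exp (-(t * r ^ 2)))) (Set.Ioi 0) := by
    intro t ht
    have ht' : (0 : ℝ) < t := ht
    dsimp only
    rw [Real.mul_rpow hr2.le ht'.le, ← mul_assoc, ← mul_assoc, ← Real.rpow_add hr2,
      show s / 2 + 1 + (-s / 2 - 1) = 0 by ring, Real.rpow_zero, one_mul, mul_comm (r ^ 2) t]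
  constructor
  · refine IntegrableOn.congr_fun ?_ key measurableSet_Ioi
    refine Integrable.const_mul ?_ _
    have := (integrableOn_Ioi_comp_mul_left_iff
      (fun t : ℝ => t ^ (-s / 2 - 1) * (1 - Real.exp (-t))) 0 hr2).2
      (by rw [mul_zero]; exact (aux_G s hs hs2).1)
    exact this
  · rw [← setIntegral_congr_fun measurableSet_Ioi key, integral_const_mul,
      integral_comp_mul_left_Ioi (fun t : ℝ => t ^ (-s / 2 - 1) * (1 - Real.exp (-t))) 0 hr2,
      mul_zero, smul_eq_mul, ← mul_assoc, mul_comm]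
    congr 1
    rw [Real.rpow_add_one hr2.ne', mul_assoc, mul_inv_cancel₀ hr2.ne', mul_one,
      ← Real.rpow_natCast, ← Real.rpow_mul hr.le]
    congr 1; push_cast; ring

lemma aux_rep (s : ℝ) (hs0 : s ≠ 0) (hs2 : s < 2) : ∃ κ σ c : ℝ, 0 < c ∧ |σ| = 1 ∧
    (∀ t r : ℝ, 0 < t → 0 ≤ κ + σ * Real.exp (-(t * r ^ 2))) ∧ ∀ r : ℝ, 0 < r →
    IntegrableOn (fun t : ℝ => t ^ (-s / 2 - 1) * (κ + σ * Real.exp (-(t * r ^ 2)))) (Set.Ioi 0) ∧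
    ∫ t in Set.Ioi 0, t ^ (-s / 2 - 1) * (κ + σ * Real.exp (-(t * r ^ 2))) = c * r ^ s := by
  rcases lt_or_gt_of_ne hs0 with hs | hs
  · refine ⟨0, 1, Real.Gamma (-s / 2), Real.Gamma_pos_of_pos (by linarith), by simp,
      fun t r _ => by positivity, fun r hr => ?_⟩
    simpa using aux_rep_neg s r hs hr
  · refine ⟨1, -1, _, (aux_G s hs hs2).2, by simp, fun t r ht => ?_, fun r hr => ?_⟩
    · have : Real.exp (-(t * r ^ 2)) ≤ 1 := Real.exp_le_one_iff.2 (by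
        have : 0 ≤ t * r ^ 2 := by positivity
        linarith)
      linarith
    · simpa [← sub_eq_add_neg] using aux_rep_pos s r hs hs2 hr

lemma aux_inv (α b : ℝ) (hα : 0 < α) (hb : 0 < b) :
    ∫⁻ t in Set.Ioi (0 : ℝ), ENNReal.ofReal (t ^ (-α - 1) * Real.exp (-(b / t))) =
      ENNReal.ofReal (Real.Gamma α * b ^ (-α)) := by
  have hI : IntegrableOn (fun t : ℝ => t ^ (α - 1) * Real.exp (-(b * t))) (Set.Ioi 0) := by
    have := integrableOn_rpow_mul_exp_neg_mul_rpow (p := 1) (s := α - 1) (b := b)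
      (by linarith) one_pos hb
    refine this.congr_fun (fun t ht => ?_) measurableSet_Ioi
    dsimp only
    rw [Real.rpow_one, neg_mul]
  have hv := Real.integral_rpow_mul_exp_neg_mul_Ioi hα hb
  have key : Set.EqOn (fun t : ℝ => (|(-1 : ℝ)| * t ^ ((-1 : ℝ) - 1)) •
      ((t ^ (-1 : ℝ)) ^ (α - 1) * Real.exp (-(b * t ^ (-1 : ℝ)))))
      (fun t : ℝ => t ^ (-α - 1) * Real.exp (-(b / t))) (Set.Ioi 0) := by
    intro t ht
    have ht' : (0 : ℝ) < t := ht
    simp only [abs_neg, abs_one, one_mul, smul_eq_mul]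
    rw [← Real.rpow_mul ht'.le, ← mul_assoc, ← Real.rpow_add ht', Real.rpow_neg_one, ← div_eq_mul_inv]
    congr 2; ring
  have hI2 : IntegrableOn (fun t : ℝ => t ^ (-α - 1) * Real.exp (-(b / t))) (Set.Ioi 0) := by
    refine IntegrableOn.congr_fun ?_ key measurableSet_Ioi
    exact (integrableOn_Ioi_comp_rpow_iff
      (fun t : ℝ => t ^ (α - 1) * Real.exp (-(b * t))) (by norm_num)).2 hI
  rw [← ofReal_integral_eq_lintegral_ofReal hI2]
  · congr 1
    rw [← setIntegral_congr_fun measurableSet_Ioi key,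
      integral_comp_rpow_Ioi (fun t : ℝ => t ^ (α - 1) * Real.exp (-(b * t))) (by norm_num), hv,
      mul_comm, one_div, Real.inv_rpow hb.le, Real.rpow_neg hb.le]
  · filter_upwards [ae_restrict_mem measurableSet_Ioi] with t ht
    have ht' : (0 : ℝ) < t := ht
    show 0 ≤ t ^ (-α - 1) * Real.exp (-(b / t))
    positivity

lemma aux_gauss (d : ℕ) (t : ℝ) (ht : 0 < t) (w : EuclideanSpace ℝ (Fin d)) :
    ((Real.exp (-(t * ‖w‖ ^ 2)) : ℝ) : ℂ) = (((4 * Real.pi * t) ^ ((d : ℝ) / 2))⁻¹ : ℝ) *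
      ∫ ξ : EuclideanSpace ℝ (Fin d), ((Real.exp (-(‖ξ‖ ^ 2 / (4 * t))) : ℝ) : ℂ) *
        Complex.exp ((inner ℝ w ξ : ℝ) * Complex.I) := by
  have hb : 0 < ((1 / (4 * t) : ℝ) : ℂ).re := by
    rw [Complex.ofReal_re]; positivity
  have h := GaussianFourier.integral_cexp_neg_mul_sq_norm_add hb Complex.I w
  have e1 : (fun ξ : EuclideanSpace ℝ (Fin d) => ((Real.exp (-(‖ξ‖ ^ 2 / (4 * t))) : ℝ) : ℂ) *
        Complex.exp ((inner ℝ w ξ : ℝ) * Complex.I)) = fun ξ =>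
      Complex.exp (-((1 / (4 * t) : ℝ) : ℂ) * ‖ξ‖ ^ 2 + Complex.I * (inner ℝ w ξ : ℝ)) := by
    funext ξ
    rw [Complex.ofReal_exp, ← Complex.exp_add]
    congr 1; push_cast; ring
  rw [e1, h, finrank_euclideanSpace, Fintype.card_fin]
  have e2 : ((Real.pi : ℂ) / ((1 / (4 * t) : ℝ) : ℂ)) ^ ((d : ℂ) / 2) =
      (((4 * Real.pi * t) ^ ((d : ℝ) / 2) : ℝ) : ℂ) := by
    rw [Complex.ofReal_cpow (by positivity)]
    congr 1
    · push_cast; field_simp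
    · push_cast; ring
  have hne : (4 * Real.pi * t) ^ ((d : ℝ) / 2) ≠ 0 := by positivity
  rw [e2, ← mul_assoc, ← Complex.ofReal_mul, inv_mul_cancel₀ hne, Complex.ofReal_one, one_mul,
    Complex.ofReal_exp]
  congr 1
  have htc : (t : ℂ) ≠ 0 := by exact_mod_cast ht.ne'
  push_cast
  rw [Complex.I_sq]
  field_simp

lemma aux_gauss_int (d : ℕ) (t : ℝ) (ht : 0 < t) :
    Integrable (fun ξ : EuclideanSpace ℝ (Fin d) => Real.exp (-(‖ξ‖ ^ 2 / (4 * t)))) := by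
  have hb : 0 < ((1 / (4 * t) : ℝ) : ℂ).re := by
    rw [Complex.ofReal_re]; positivity
  have h := (GaussianFourier.integrable_cexp_neg_mul_sq_norm_add hb 0 (0 : EuclideanSpace ℝ (Fin d))).norm
  refine h.congr (Eventually.of_forall fun ξ => ?_)
  dsimp only
  rw [Complex.norm_exp]
  congr 1
  have : (-((1 / (4 * t) : ℝ) : ℂ) * ‖ξ‖ ^ 2 + 0 * ((inner ℝ 0 ξ : ℝ) : ℂ)) =
    ((-(‖ξ‖ ^ 2 / (4 * t)) : ℝ) : ℂ) := by push_cast; ring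
  rw [this, Complex.ofReal_re]

lemma aux_smooth (d : ℕ) (ν : Measure (EuclideanSpace ℝ (Fin d))) [IsProbabilityMeasure ν]
    (t : ℝ) (ht : 0 < t) (x : EuclideanSpace ℝ (Fin d)) :
    ((∫ w, Real.exp (-(t * ‖x - w‖ ^ 2)) ∂ν : ℝ) : ℂ) =
      (((4 * Real.pi * t) ^ ((d : ℝ) / 2))⁻¹ : ℝ) *
      ∫ ξ : EuclideanSpace ℝ (Fin d), ((Real.exp (-(‖ξ‖ ^ 2 / (4 * t))) : ℝ) : ℂ) *
        Complex.exp ((inner ℝ x ξ : ℝ) * Complex.I) * charFun ν (-ξ) := by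
  rw [← integral_complex_ofReal]
  simp_rw [aux_gauss d t ht]
  rw [integral_const_mul]
  congr 1
  rw [integral_integral_swap]
  · refine integral_congr_ae (Eventually.of_forall fun ξ => ?_)
    dsimp only
    rw [charFun_apply, ← integral_const_mul]
    refine integral_congr_ae (Eventually.of_forall fun w => ?_)
    dsimp only
    rw [mul_assoc, ← Complex.exp_add, inner_sub_left, inner_neg_right]
    congr 2; push_cast; ring
  · have h1 : Integrable (fun z : EuclideanSpace ℝ (Fin d) × EuclideanSpace ℝ (Fin d) =>
        (1 : ℝ) * Real.exp (-(‖z.2‖ ^ 2 / (4 * t)))) (ν.prod volume) :=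
      Integrable.mul_prod (integrable_const (1 : ℝ)) (aux_gauss_int d t ht)
    refine h1.mono' ?_ (Eventually.of_forall fun z => ?_)
    · apply Continuous.aestronglyMeasurable
      unfold Function.uncurry
      fun_prop
    · simp only [Function.uncurry]
      rw [norm_mul, Complex.norm_exp_ofReal_mul_I, Complex.norm_real,
        Real.norm_of_nonneg (Real.exp_pos _).le]
      simp

lemma aux_smooth_int (d : ℕ) (ν : Measure (EuclideanSpace ℝ (Fin d))) [IsProbabilityMeasure ν]
    (t : ℝ) (ht : 0 < t) (x : EuclideanSpace ℝ (Fin d)) :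
    Integrable (fun ξ : EuclideanSpace ℝ (Fin d) =>
      ((Real.exp (-(‖ξ‖ ^ 2 / (4 * t))) : ℝ) : ℂ) *
        Complex.exp ((inner ℝ x ξ : ℝ) * Complex.I) * charFun ν (-ξ)) := by
  refine (aux_gauss_int d t ht).mono' ?_ (Eventually.of_forall fun ξ => ?_)
  · have h1 : Measurable (fun ξ : EuclideanSpace ℝ (Fin d) => charFun ν (-ξ)) :=
      measurable_charFun.comp measurable_neg
    have h2 : Continuous (fun ξ : EuclideanSpace ℝ (Fin d) =>
      ((Real.exp (-(‖ξ‖ ^ 2 / (4 * t))) : ℝ) : ℂ) *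
        Complex.exp ((inner ℝ x ξ : ℝ) * Complex.I)) := by fun_prop
    exact (h2.measurable.mul h1).aestronglyMeasurable
  · rw [norm_mul, norm_mul, Complex.norm_exp_ofReal_mul_I, Complex.norm_real,
        Real.norm_of_nonneg (Real.exp_pos _).le, mul_one]
    exact mul_le_of_le_one_right (Real.exp_pos _).le (norm_charFun_le_one _)

lemma aux_defect_t (d : ℕ) (ν : Measure (EuclideanSpace ℝ (Fin d))) [IsProbabilityMeasure ν]
    (t : ℝ) (ht : 0 < t) (x y : EuclideanSpace ℝ (Fin d)) (a b : ℝ) (ha : 0 ≤ a) (hb : 0 ≤ b)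
    (hab : a + b = 1) :
    ‖a * (∫ w, Real.exp (-(t * ‖x - w‖ ^ 2)) ∂ν) + b * (∫ w, Real.exp (-(t * ‖y - w‖ ^ 2)) ∂ν)
      - ∫ w, Real.exp (-(t * ‖(a • x + b • y) - w‖ ^ 2)) ∂ν‖ₑ ≤
    ENNReal.ofReal (2 * (a * b) * ‖x - y‖ ^ 2) *
      ∫⁻ ξ : EuclideanSpace ℝ (Fin d), ENNReal.ofReal
        (((4 * Real.pi * t) ^ ((d : ℝ) / 2))⁻¹ * Real.exp (-(‖ξ‖ ^ 2 / (4 * t))) * ‖ξ‖ ^ 2) *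
        ‖charFun ν ξ‖ₑ := by
  set A : ℝ := ((4 * Real.pi * t) ^ ((d : ℝ) / 2))⁻¹ with hA
  have hA0 : 0 ≤ A := by positivity
  set D := a * (∫ w, Real.exp (-(t * ‖x - w‖ ^ 2)) ∂ν) + b * (∫ w, Real.exp (-(t * ‖y - w‖ ^ 2)) ∂ν)
      - ∫ w, Real.exp (-(t * ‖(a • x + b • y) - w‖ ^ 2)) ∂ν with hD
  have hDc : (D : ℂ) = ∫ ξ : EuclideanSpace ℝ (Fin d),
      (A * Real.exp (-(‖ξ‖ ^ 2 / (4 * t))) : ℝ) *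
      (a * Complex.exp ((inner ℝ x ξ : ℝ) * Complex.I)
       + b * Complex.exp ((inner ℝ y ξ : ℝ) * Complex.I)
       - Complex.exp ((a * inner ℝ x ξ + b * inner ℝ y ξ : ℝ) * Complex.I)) * charFun ν (-ξ) := by
    rw [hD]
    push_cast [-Complex.ofReal_exp]
    have := fun x => aux_smooth d ν t ht x
    push_cast [-Complex.ofReal_exp] at this
    have i := fun x => aux_smooth_int d ν t ht x
    rw [aux_smooth d ν t ht, aux_smooth d ν t ht, aux_smooth d ν t ht, ← hA]
    rw [← integral_const_mul, ← integral_const_mul, ← integral_const_mul, ← integral_const_mul,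
      ← integral_const_mul, ← integral_add, ← integral_sub]
    · refine integral_congr_ae (Eventually.of_forall fun ξ => ?_)
      dsimp only
      rw [inner_add_left, inner_smul_left, inner_smul_left]
      simp only [conj_trivial]
      push_cast
      ring
    · exact (((i x).const_mul _).const_mul _).add (((i y).const_mul _).const_mul _)
    · exact (i _).const_mul _
    · exact (((i x).const_mul _).const_mul _)
    · exact (((i y).const_mul _).const_mul _)
  have hn : ‖D‖ₑ = ‖(D : ℂ)‖ₑ := by
    rw [← ofReal_norm, ← ofReal_norm, Complex.norm_real]
  rw [hn, hDc, ← lintegral_const_mul']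
  swap
  · exact ENNReal.ofReal_ne_top
  refine (enorm_integral_le_lintegral_enorm _).trans (lintegral_mono fun ξ => ?_)
  rw [enorm_mul, ← mul_assoc]
  have hc : ‖charFun ν (-ξ)‖ₑ = ‖charFun ν ξ‖ₑ := by
    rw [charFun_neg, ← ofReal_norm, ← ofReal_norm, RCLike.norm_conj]
  rw [hc]
  gcongr
  rw [← ENNReal.ofReal_mul (by positivity), ← ofReal_norm]
  apply ENNReal.ofReal_le_ofReal
  have hAe : 0 ≤ A * Real.exp (-(‖ξ‖ ^ 2 / (4 * t))) := by positivity
  rw [norm_mul, Complex.norm_real, Real.norm_of_nonneg hAe]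
  have h1 := aux_exp_defect a b (inner ℝ x ξ) (inner ℝ y ξ) ha hb hab
  have h2 : (inner ℝ x ξ - inner ℝ y ξ) ^ 2 ≤ (‖x - y‖ * ‖ξ‖) ^ 2 := by
    rw [← inner_sub_left, ← sq_abs]
    exact pow_le_pow_left₀ (abs_nonneg _) (abs_real_inner_le_norm _ _) 2
  have h3 : 0 ≤ a * b := mul_nonneg ha hb
  calc _ ≤ (A * Real.exp (-(‖ξ‖ ^ 2 / (4 * t)))) * (2 * (a * b) * (‖x - y‖ * ‖ξ‖) ^ 2) :=
        mul_le_mul_of_nonneg_left (h1.trans (by gcongr)) hAe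
    _ = _ := by ring

lemma aux_kernel (d : ℕ) (s : ℝ) (hs : 0 < s + d) : ∃ C : ℝ, 0 < C ∧
    ∀ h : EuclideanSpace ℝ (Fin d) → ℝ≥0∞, Measurable h →
    ∫⁻ t in Set.Ioi (0 : ℝ), ENNReal.ofReal (t ^ (-s / 2 - 1)) *
      ∫⁻ ξ : EuclideanSpace ℝ (Fin d), ENNReal.ofReal
        (((4 * Real.pi * t) ^ ((d : ℝ) / 2))⁻¹ * Real.exp (-(‖ξ‖ ^ 2 / (4 * t))) * ‖ξ‖ ^ 2) * h ξ
    ≤ ENNReal.ofReal C * ∫⁻ ξ : EuclideanSpace ℝ (Fin d),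
        ENNReal.ofReal (‖ξ‖ ^ (2 - s - d)) * h ξ := by
  set α : ℝ := (s + d) / 2 with hα
  have hα0 : 0 < α := by positivity
  set C : ℝ := ((4 * Real.pi) ^ ((d : ℝ) / 2))⁻¹ * Real.Gamma α * (4 : ℝ) ^ α with hC
  have hΓ := Real.Gamma_pos_of_pos hα0
  refine ⟨C, by positivity, fun h hh => ?_⟩
  have e0 : ∀ t : ℝ, ENNReal.ofReal (t ^ (-s / 2 - 1)) *
      ∫⁻ ξ : EuclideanSpace ℝ (Fin d), ENNReal.ofReal
        (((4 * Real.pi * t) ^ ((d : ℝ) / 2))⁻¹ * Real.exp (-(‖ξ‖ ^ 2 / (4 * t))) * ‖ξ‖ ^ 2) * h ξ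
      = ∫⁻ ξ : EuclideanSpace ℝ (Fin d), ENNReal.ofReal (t ^ (-s / 2 - 1)) * (ENNReal.ofReal
        (((4 * Real.pi * t) ^ ((d : ℝ) / 2))⁻¹ * Real.exp (-(‖ξ‖ ^ 2 / (4 * t))) * ‖ξ‖ ^ 2) * h ξ) :=
    fun t => (lintegral_const_mul' _ _ ENNReal.ofReal_ne_top).symm
  simp_rw [e0]
  rw [lintegral_lintegral_swap]
  swap
  · apply Measurable.aemeasurable
    unfold Function.uncurry
    fun_prop
  rw [← lintegral_const_mul' _ _ ENNReal.ofReal_ne_top]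
  refine lintegral_mono fun ξ => ?_
  dsimp only
  rcases eq_or_ne ξ 0 with rfl | hξ
  · simp
  have hξ' : 0 < ‖ξ‖ := norm_pos_iff.2 hξ
  have hb : 0 < ‖ξ‖ ^ 2 / 4 := by positivity
  have e1 : ∀ t ∈ Set.Ioi (0 : ℝ), ENNReal.ofReal (t ^ (-s / 2 - 1)) * (ENNReal.ofReal
        (((4 * Real.pi * t) ^ ((d : ℝ) / 2))⁻¹ * Real.exp (-(‖ξ‖ ^ 2 / (4 * t))) * ‖ξ‖ ^ 2) * h ξ)
      = ENNReal.ofReal (t ^ (-α - 1) * Real.exp (-((‖ξ‖ ^ 2 / 4) / t))) *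
        (ENNReal.ofReal (((4 * Real.pi) ^ ((d : ℝ) / 2))⁻¹ * ‖ξ‖ ^ 2) * h ξ) := by
    intro t ht
    have ht' : (0 : ℝ) < t := ht
    rw [← mul_assoc, ← mul_assoc, ← ENNReal.ofReal_mul (by positivity),
      ← ENNReal.ofReal_mul (by positivity)]
    congr 2
    rw [Real.mul_rpow (by positivity) ht'.le, mul_inv, ← Real.rpow_neg ht'.le]
    have : t ^ (-α - 1) = t ^ (-s / 2 - 1) * t ^ (-((d : ℝ) / 2)) := by
      rw [← Real.rpow_add ht']; congr 1; rw [hα]; ring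
    rw [this, div_div]; ring
  rw [setLIntegral_congr_fun measurableSet_Ioi e1, lintegral_mul_const _ (by fun_prop),
    aux_inv α _ hα0 hb, ← mul_assoc, ← mul_assoc, ← ENNReal.ofReal_mul (by positivity),
    ← ENNReal.ofReal_mul (by positivity)]
  refine le_of_eq ?_
  congr 2
  have e2 : (‖ξ‖ ^ 2 / 4) ^ (-α) = ‖ξ‖ ^ (- s - d) * 4 ^ α := by
    rw [Real.div_rpow (by positivity) (by norm_num), Real.rpow_neg (by norm_num : (0 : ℝ) ≤ 4),
      div_inv_eq_mul, ← Real.rpow_natCast, ← Real.rpow_mul hξ'.le]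
    congr 2; rw [hα]; push_cast; ring
  have e3 : ‖ξ‖ ^ (2 - s - d) = ‖ξ‖ ^ (- s - d) * ‖ξ‖ ^ 2 := by
    rw [← Real.rpow_natCast, ← Real.rpow_add hξ']; congr 1; push_cast; ring
  rw [e2, e3, hC]; ring

lemma aux_main (d : ℕ) (s : ℝ) (hs0 : s ≠ 0) (hs2 : s < 2) (hsd : 0 < s + d) :
    ∃ C : ℝ, 0 < C ∧ ∀ (ν : Measure (EuclideanSpace ℝ (Fin d))), IsProbabilityMeasure ν →
    (∀ x, Integrable (fun w => ‖x - w‖ ^ s) ν) → (∀ x, ∀ᵐ w ∂ν, w ≠ x) →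
    ∀ H : ℝ, 0 ≤ H →
    (∫⁻ ξ : EuclideanSpace ℝ (Fin d), ENNReal.ofReal (‖ξ‖ ^ (2 - s - d)) * ‖charFun ν ξ‖ₑ
      ≤ ENNReal.ofReal H) →
    ∀ (x y : EuclideanSpace ℝ (Fin d)) (a b : ℝ), 0 ≤ a → 0 ≤ b → a + b = 1 →
    |a * (∫ w, ‖x - w‖ ^ s ∂ν) + b * (∫ w, ‖y - w‖ ^ s ∂ν) - ∫ w, ‖(a • x + b • y) - w‖ ^ s ∂ν|
      ≤ C * H * (a * b) * ‖x - y‖ ^ 2 := by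
  obtain ⟨κ, σ, c, hc, hσ, hnn, hrep⟩ := aux_rep s hs0 hs2
  obtain ⟨C, hC, hker⟩ := aux_kernel d s hsd
  refine ⟨2 * C / c, by positivity, fun ν hν hIntg hne H hH hHb x y a b ha hb hab => ?_⟩
  set G : ℝ → EuclideanSpace ℝ (Fin d) → ℝ :=
    fun t x => ∫ w, Real.exp (-(t * ‖x - w‖ ^ 2)) ∂ν with hG
  have hGint : ∀ (t : ℝ) (x : EuclideanSpace ℝ (Fin d)), 0 < t →
      Integrable (fun w => Real.exp (-(t * ‖x - w‖ ^ 2))) ν := by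
    intro t x ht
    refine (integrable_const (1 : ℝ)).mono' ?_ (Eventually.of_forall fun w => ?_)
    · exact (by fun_prop : Continuous fun w => Real.exp (-(t * ‖x - w‖ ^ 2))).aestronglyMeasurable
    · rw [Real.norm_of_nonneg (Real.exp_pos _).le]
      exact Real.exp_le_one_iff.2 (by
        have : 0 ≤ t * ‖x - w‖ ^ 2 := by positivity
        linarith)
  set F : EuclideanSpace ℝ (Fin d) → EuclideanSpace ℝ (Fin d) → ℝ → ℝ :=
    fun x w t => t ^ (-s / 2 - 1) * (κ + σ * Real.exp (-(t * ‖x - w‖ ^ 2))) with hF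
  have hpos : ∀ x w : EuclideanSpace ℝ (Fin d), w ≠ x → 0 < ‖x - w‖ := fun x w h =>
    norm_pos_iff.2 (sub_ne_zero.2 (Ne.symm h))
  have hFint : ∀ x, Integrable (Function.uncurry (F x)) (ν.prod (volume.restrict (Set.Ioi 0))) := by
    intro x
    rw [integrable_prod_iff]
    · constructor
      · filter_upwards [hne x] with w hw
        exact (hrep _ (hpos x w hw)).1
      · refine ((hIntg x).const_mul c).congr ?_
        filter_upwards [hne x] with w hw
        rw [← (hrep _ (hpos x w hw)).2]
        refine setIntegral_congr_fun measurableSet_Ioi (fun t ht => ?_)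
        have ht' : (0 : ℝ) < t := ht
        dsimp only [Function.uncurry, F]
        rw [Real.norm_of_nonneg (mul_nonneg (Real.rpow_nonneg ht'.le _) (hnn t _ ht'))]
    · apply Measurable.aestronglyMeasurable
      simp only [hF]
      unfold Function.uncurry
      fun_prop
  have hin : ∀ x, ∀ t ∈ Set.Ioi (0 : ℝ), ∫ w, F x w t ∂ν =
      t ^ (-s / 2 - 1) * (κ + σ * G t x) := by
    intro x t ht
    simp only [hF]
    rw [integral_const_mul, integral_add (integrable_const _) ((hGint t x ht).const_mul _),
      integral_const_mul]
    simp [hG]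
  have hJint : ∀ x, IntegrableOn (fun t => t ^ (-s / 2 - 1) * (κ + σ * G t x)) (Set.Ioi 0) := by
    intro x
    have h1 : IntegrableOn (fun t => ∫ w, F x w t ∂ν) (Set.Ioi 0) := (hFint x).integral_prod_right
    exact h1.congr_fun (hin x) measurableSet_Ioi
  have hU : ∀ x, c * ∫ w, ‖x - w‖ ^ s ∂ν =
      ∫ t in Set.Ioi 0, t ^ (-s / 2 - 1) * (κ + σ * G t x) := by
    intro x
    rw [← setIntegral_congr_fun measurableSet_Ioi (hin x), ← integral_integral_swap (hFint x),
      ← integral_const_mul]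
    refine integral_congr_ae ?_
    filter_upwards [hne x] with w hw
    exact ((hrep _ (hpos x w hw)).2).symm
  set D := a * (∫ w, ‖x - w‖ ^ s ∂ν) + b * (∫ w, ‖y - w‖ ^ s ∂ν)
    - ∫ w, ‖(a • x + b • y) - w‖ ^ s ∂ν with hD
  have hcD : c * D = ∫ t in Set.Ioi 0, t ^ (-s / 2 - 1) *
      (σ * (a * G t x + b * G t y - G t (a • x + b • y))) := by
    have : c * D = a * (c * (∫ w, ‖x - w‖ ^ s ∂ν)) + b * (c * ∫ w, ‖y - w‖ ^ s ∂ν)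
      - c * ∫ w, ‖(a • x + b • y) - w‖ ^ s ∂ν := by rw [hD]; ring
    rw [this, hU, hU, hU, ← integral_const_mul, ← integral_const_mul, ← integral_add, ← integral_sub]
    · refine integral_congr_ae (Eventually.of_forall fun t => ?_)
      dsimp only
      have hb' : b = 1 - a := by linarith
      generalize G t (a • x + b • y) = g
      rw [hb']; ring
    · exact ((hJint x).const_mul a).add ((hJint y).const_mul b)
    · exact hJint _
    · exact (hJint x).const_mul a
    · exact (hJint y).const_mul b
  have hbound : ‖c * D‖ₑ ≤ ENNReal.ofReal (2 * (a * b) * ‖x - y‖ ^ 2 * (C * H)) := by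
    rw [hcD]
    refine (enorm_integral_le_lintegral_enorm _).trans ?_
    have step : ∫⁻ t in Set.Ioi (0 : ℝ), ‖t ^ (-s / 2 - 1) *
        (σ * (a * G t x + b * G t y - G t (a • x + b • y)))‖ₑ ≤
        ∫⁻ t in Set.Ioi (0 : ℝ), ENNReal.ofReal (2 * (a * b) * ‖x - y‖ ^ 2) *
        (ENNReal.ofReal (t ^ (-s / 2 - 1)) *
        ∫⁻ ξ : EuclideanSpace ℝ (Fin d), ENNReal.ofReal
        (((4 * Real.pi * t) ^ ((d : ℝ) / 2))⁻¹ * Real.exp (-(‖ξ‖ ^ 2 / (4 * t))) * ‖ξ‖ ^ 2) *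
        ‖charFun ν ξ‖ₑ) := by
      refine setLIntegral_mono' measurableSet_Ioi (fun t ht => ?_)
      have ht' : (0 : ℝ) < t := ht
      have hσ' : ‖σ‖ₑ = 1 := by rw [← ofReal_norm, Real.norm_eq_abs, hσ]; simp
      rw [enorm_mul, enorm_mul, hσ', one_mul,
        Real.enorm_of_nonneg (Real.rpow_nonneg ht'.le _), mul_left_comm]
      gcongr
      exact aux_defect_t d ν t ht' x y a b ha hb hab
    refine step.trans ?_
    rw [lintegral_const_mul' _ _ ENNReal.ofReal_ne_top,
      ENNReal.ofReal_mul (p := 2 * (a * b) * ‖x - y‖ ^ 2) (q := C * H) (by positivity)]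
    refine mul_le_mul' le_rfl ?_
    refine (hker _ measurable_charFun.enorm).trans ?_
    rw [ENNReal.ofReal_mul hC.le]
    exact mul_le_mul' le_rfl hHb
  rw [← ofReal_norm, ENNReal.ofReal_le_ofReal_iff (by positivity), Real.norm_eq_abs, abs_mul,
    abs_of_pos hc] at hbound
  rw [show 2 * C / c * H * (a * b) * ‖x - y‖ ^ 2 = (2 * (a * b) * ‖x - y‖ ^ 2 * (C * H)) / c by ring,
    le_div_iff₀ hc, mul_comm]
  exact hbound

/-- The measure with density `g`. -/
def dens (d : ℕ) (g : EuclideanSpace ℝ (Fin d) → ℝ) : Measure (EuclideanSpace ℝ (Fin d)) :=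
  volume.withDensity (fun x => ENNReal.ofReal (g x))

/-- The hypotheses on the density that the argument uses. -/
structure GoodDens (d : ℕ) (g : EuclideanSpace ℝ (Fin d) → ℝ) (B : ℝ) : Prop where
  cont : Continuous g
  nonneg : ∀ x, 0 ≤ g x
  le : ∀ x, g x ≤ B
  even : ∀ x, g (-x) = g x
  int : Integrable g
  one : ∫ x, g x = 1
  mom : Integrable (fun x => g x * ‖x‖ ^ 2)

lemma dens_integral {d : ℕ} {g : EuclideanSpace ℝ (Fin d) → ℝ} {B : ℝ} (hg : GoodDens d g B)
    {V : Type*} [NormedAddCommGroup V] [NormedSpace ℝ V] (f : EuclideanSpace ℝ (Fin d) → V) :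
    ∫ x, f x ∂(dens d g) = ∫ x, g x • f x := by
  rw [dens, integral_withDensity_eq_integral_toReal_smul (by
    exact hg.cont.measurable.ennreal_ofReal) (by simp)]
  refine integral_congr_ae (Eventually.of_forall fun x => ?_)
  dsimp only
  rw [ENNReal.toReal_ofReal (hg.nonneg x)]

lemma dens_prob {d : ℕ} {g : EuclideanSpace ℝ (Fin d) → ℝ} {B : ℝ} (hg : GoodDens d g B) :
    IsProbabilityMeasure (dens d g) := by
  constructor
  rw [dens, withDensity_apply _ MeasurableSet.univ, Measure.restrict_univ,
    ← ofReal_integral_eq_lintegral_ofReal hg.int (Eventually.of_forall hg.nonneg), hg.one]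
  simp

lemma dens_le {d : ℕ} {g : EuclideanSpace ℝ (Fin d) → ℝ} {B : ℝ} (hg : GoodDens d g B)
    (f : EuclideanSpace ℝ (Fin d) → ℝ≥0∞) (hf : Measurable f) :
    ∫⁻ x, f x ∂(dens d g) ≤ ENNReal.ofReal B * ∫⁻ x, f x := by
  rw [dens, lintegral_withDensity_eq_lintegral_mul _ hg.cont.measurable.ennreal_ofReal hf,
    ← lintegral_const_mul _ hf]
  refine lintegral_mono fun x => ?_
  simp only [Pi.mul_apply]
  gcongr
  exact hg.le x

lemma conv_le {d : ℕ} {g : EuclideanSpace ℝ (Fin d) → ℝ} {B : ℝ} (hg : GoodDens d g B)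
    (f : EuclideanSpace ℝ (Fin d) → ℝ≥0∞) (hf : Measurable f) :
    ∫⁻ x, f x ∂((dens d g) ∗ (dens d g)) ≤ ENNReal.ofReal B * ∫⁻ x, f x := by
  have := dens_prob hg
  rw [Measure.lintegral_conv hf]
  calc ∫⁻ x, ∫⁻ y, f (x + y) ∂(dens d g) ∂(dens d g)
      ≤ ∫⁻ x, (ENNReal.ofReal B * ∫⁻ y, f y) ∂(dens d g) := by
        refine lintegral_mono fun x => ?_
        refine (dens_le hg _ (by fun_prop)).trans ?_
        rw [lintegral_add_left_eq_self]
    _ = _ := by simp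

lemma conv_ne {d : ℕ} (hd : 1 ≤ d) {g : EuclideanSpace ℝ (Fin d) → ℝ} {B : ℝ} (hg : GoodDens d g B)
    (x : EuclideanSpace ℝ (Fin d)) : ∀ᵐ w ∂((dens d g) ∗ (dens d g)), w ≠ x := by
  have : Nonempty (Fin d) := ⟨⟨0, hd⟩⟩
  have h := conv_le hg (Set.indicator {x} 1) (measurable_one.indicator (measurableSet_singleton x))
  rw [lintegral_indicator_one (measurableSet_singleton x),
    lintegral_indicator_one (measurableSet_singleton x), measure_singleton (μ := volume), mul_zero] at h
  rw [ae_iff]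
  simpa using h

lemma conv_int_neg {d : ℕ} (hd : 1 ≤ d) {g : EuclideanSpace ℝ (Fin d) → ℝ} {B : ℝ}
    (hg : GoodDens d g B) (s : ℝ) (hs : s < 0) (hsd : -(d : ℝ) < s)
    (x : EuclideanSpace ℝ (Fin d)) :
    Integrable (fun w => ‖x - w‖ ^ s) ((dens d g) ∗ (dens d g)) := by
  have := dens_prob hg
  have hm : Measurable (fun w : EuclideanSpace ℝ (Fin d) => ‖x - w‖ ^ s) := by fun_prop
  refine ⟨hm.aestronglyMeasurable, ?_⟩
  set k : EuclideanSpace ℝ (Fin d) → ℝ≥0∞ :=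
    Set.indicator (Metric.ball 0 1) (fun u => ‖‖u‖ ^ s‖ₑ) with hk
  have hkm : Measurable k :=
    (by fun_prop : Measurable fun u : EuclideanSpace ℝ (Fin d) => ‖‖u‖ ^ s‖ₑ).indicator
      measurableSet_ball
  have hkfin : ∫⁻ u, k u < ⊤ := by
    rw [hk, lintegral_indicator measurableSet_ball]
    exact (aux_ball d hd s hsd).2
  have hle : ∀ w, ‖‖x - w‖ ^ s‖ₑ ≤ 1 + k (x - w) := by
    intro w
    by_cases h : x - w ∈ Metric.ball (0 : EuclideanSpace ℝ (Fin d)) 1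
    · rw [hk, Set.indicator_of_mem h]; exact le_add_self
    · refine le_trans ?_ le_self_add
      rw [mem_ball_zero_iff, not_lt] at h
      rw [Real.enorm_of_nonneg (by positivity), ← ENNReal.ofReal_one]
      exact ENNReal.ofReal_le_ofReal (Real.rpow_le_one_of_one_le_of_nonpos h hs.le)
  refine (lintegral_mono hle).trans_lt ?_
  rw [lintegral_add_left measurable_const]
  refine ENNReal.add_lt_top.2 ⟨by simp, ?_⟩
  refine (conv_le hg _ (by fun_prop)).trans_lt ?_
  rw [lintegral_sub_left_eq_self]
  exact ENNReal.mul_lt_top ENNReal.ofReal_lt_top hkfin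

lemma dens_mom {d : ℕ} {g : EuclideanSpace ℝ (Fin d) → ℝ} {B : ℝ} (hg : GoodDens d g B) :
    Integrable (fun x => ‖x‖ ^ 2) (dens d g) := by
  rw [dens, integrable_withDensity_iff_integrable_smul' hg.cont.measurable.ennreal_ofReal (by simp)]
  refine hg.mom.congr (Eventually.of_forall fun x => ?_)
  dsimp only
  rw [ENNReal.toReal_ofReal (hg.nonneg x), smul_eq_mul]

lemma conv_int_pos {d : ℕ} {g : EuclideanSpace ℝ (Fin d) → ℝ} {B : ℝ}
    (hg : GoodDens d g B) (s : ℝ) (hs : 0 < s) (hs2 : s ≤ 2)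
    (x : EuclideanSpace ℝ (Fin d)) :
    Integrable (fun w => ‖x - w‖ ^ s) ((dens d g) ∗ (dens d g)) := by
  have := dens_prob hg
  have hm : Measurable (fun w : EuclideanSpace ℝ (Fin d) => ‖x - w‖ ^ s) := by fun_prop
  rw [Measure.conv, integrable_map_measure hm.aestronglyMeasurable (by fun_prop)]
  have hb : Integrable (fun z : EuclideanSpace ℝ (Fin d) × EuclideanSpace ℝ (Fin d) =>
      (1 + 3 * ‖x‖ ^ 2) + (3 * ‖z.1‖ ^ 2 + 3 * ‖z.2‖ ^ 2)) ((dens d g).prod (dens d g)) :=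
    (integrable_const _).add ((((dens_mom hg).comp_fst _).const_mul 3).add
      (((dens_mom hg).comp_snd _).const_mul 3))
  refine hb.mono' (by
    exact (hm.comp measurable_add).aestronglyMeasurable) (Eventually.of_forall fun z => ?_)
  simp only [Function.comp]
  rw [Real.norm_of_nonneg (by positivity)]
  set r := ‖x - (z.1 + z.2)‖ with hr
  have h0 : 0 ≤ r := norm_nonneg _
  have h1 : r ^ s ≤ 1 + r ^ 2 := by
    rcases le_total r 1 with h | h
    · have := Real.rpow_le_one h0 h hs.le
      nlinarith [sq_nonneg r]
    · have := Real.rpow_le_rpow_of_exponent_le h hs2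
      rw [Real.rpow_two] at this
      linarith
  have h2 : r ≤ ‖x‖ + (‖z.1‖ + ‖z.2‖) :=
    (norm_sub_le _ _).trans (by gcongr; exact norm_add_le _ _)
  have h3 : r ^ 2 ≤ (‖x‖ + (‖z.1‖ + ‖z.2‖)) ^ 2 := pow_le_pow_left₀ h0 h2 2
  nlinarith [sq_nonneg (‖x‖ - ‖z.1‖), sq_nonneg (‖x‖ - ‖z.2‖), sq_nonneg (‖z.1‖ - ‖z.2‖)]

lemma conv_char {d : ℕ} {g : EuclideanSpace ℝ (Fin d) → ℝ} {B : ℝ} (hg : GoodDens d g B)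
    (ξ : EuclideanSpace ℝ (Fin d)) :
    charFun ((dens d g) ∗ (dens d g)) (-ξ) = (‖charFun ((dens d g) ∗ (dens d g)) ξ‖ : ℂ) := by
  have := dens_prob hg
  have h1 : charFun (dens d g) (-ξ) = charFun (dens d g) ξ := by
    rw [charFun_apply, charFun_apply, dens_integral hg, dens_integral hg,
      ← integral_neg_eq_self]
    refine integral_congr_ae (Eventually.of_forall fun x => ?_)
    dsimp only
    rw [hg.even, inner_neg_neg]
  have h2 := charFun_neg (μ := dens d g) ξ
  rw [charFun_conv, charFun_conv, h1, norm_mul]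
  rw [h1] at h2
  have h3 := Complex.mul_conj (charFun (dens d g) ξ)
  rw [← h2] at h3
  rw [h3, Complex.normSq_eq_norm_sq]
  push_cast; ring

lemma conv_char_lint {d : ℕ} {g : EuclideanSpace ℝ (Fin d) → ℝ} {B : ℝ} (hg : GoodDens d g B)
    (hB : 0 ≤ B) :
    ∫⁻ ξ, ‖charFun ((dens d g) ∗ (dens d g)) ξ‖ₑ ≤ ENNReal.ofReal (B * (2 * Real.pi) ^ d) := by
  have := dens_prob hg
  set ν := (dens d g) ∗ (dens d g) with hν
  have key : ∀ t : ℝ, 0 < t → ∫⁻ ξ : EuclideanSpace ℝ (Fin d),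
      ENNReal.ofReal (Real.exp (-(‖ξ‖ ^ 2 / (4 * t)))) * ‖charFun ν ξ‖ₑ ≤
      ENNReal.ofReal (B * (2 * Real.pi) ^ d) := by
    intro t ht
    have h := aux_smooth d ν t ht 0
    have hi := (aux_smooth_int d ν t ht 0).norm
    have e1 : ∀ ξ : EuclideanSpace ℝ (Fin d), ((Real.exp (-(‖ξ‖ ^ 2 / (4 * t))) : ℝ) : ℂ) *
        Complex.exp ((inner ℝ 0 ξ : ℝ) * Complex.I) * charFun ν (-ξ) =
        ((Real.exp (-(‖ξ‖ ^ 2 / (4 * t))) * ‖charFun ν ξ‖ : ℝ) : ℂ) := by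
      intro ξ
      rw [conv_char hg, inner_zero_left]; push_cast; simp [hν]
    simp_rw [e1] at h hi
    rw [integral_complex_ofReal, ← Complex.ofReal_mul, Complex.ofReal_inj] at h
    have hi' : Integrable (fun ξ : EuclideanSpace ℝ (Fin d) =>
        Real.exp (-(‖ξ‖ ^ 2 / (4 * t))) * ‖charFun ν ξ‖) := by
      refine hi.congr (Eventually.of_forall fun ξ => ?_)
      dsimp only
      rw [Complex.norm_real, Real.norm_of_nonneg (by positivity)]
    have e2 : ∫⁻ ξ : EuclideanSpace ℝ (Fin d),
      ENNReal.ofReal (Real.exp (-(‖ξ‖ ^ 2 / (4 * t)))) * ‖charFun ν ξ‖ₑ =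
      ENNReal.ofReal (∫ ξ : EuclideanSpace ℝ (Fin d),
        Real.exp (-(‖ξ‖ ^ 2 / (4 * t))) * ‖charFun ν ξ‖) := by
      rw [ofReal_integral_eq_lintegral_ofReal hi'
        (Eventually.of_forall fun ξ => by positivity)]
      refine lintegral_congr fun ξ => ?_
      rw [ENNReal.ofReal_mul (by positivity), ofReal_norm]
    rw [e2]
    apply ENNReal.ofReal_le_ofReal
    have hgi : Integrable (fun w : EuclideanSpace ℝ (Fin d) => Real.exp (-t * ‖w‖ ^ 2)) := by
      have := aux_gauss_int d (1 / (4 * t)) (by positivity)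
      refine this.congr (Eventually.of_forall fun w => ?_)
      dsimp only
      congr 1; field_simp
    have hgv := GaussianFourier.integral_rexp_neg_mul_sq_norm (V := EuclideanSpace ℝ (Fin d)) ht
    rw [finrank_euclideanSpace, Fintype.card_fin] at hgv
    have h4 : ∫ w, Real.exp (-(t * ‖0 - w‖ ^ 2)) ∂ν ≤ B * (Real.pi / t) ^ ((d : ℝ) / 2) := by
      rw [integral_eq_lintegral_of_nonneg_ae (Eventually.of_forall fun w => by positivity)
        (by fun_prop)]
      refine ENNReal.toReal_le_of_le_ofReal (by positivity) ?_
      refine (conv_le hg _ (by fun_prop)).trans ?_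
      rw [ENNReal.ofReal_mul hB, ← hgv, ofReal_integral_eq_lintegral_ofReal hgi
        (Eventually.of_forall fun ξ => by positivity)]
      simp only [zero_sub, norm_neg, neg_mul, le_refl]
    rw [h] at h4
    have hA : 0 < (4 * Real.pi * t) ^ ((d : ℝ) / 2) := by positivity
    rw [inv_mul_le_iff₀ hA] at h4
    refine h4.trans (le_of_eq ?_)
    rw [mul_left_comm, ← Real.mul_rpow (by positivity) (by positivity),
      show 4 * Real.pi * t * (Real.pi / t) = (2 * Real.pi) ^ 2 by field_simp; ring,
      ← Real.rpow_natCast, ← Real.rpow_mul (by positivity), ← Real.rpow_natCast]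
    congr 2; push_cast; ring
  have hlim : ∀ ξ : EuclideanSpace ℝ (Fin d), Tendsto (fun n : ℕ =>
      ENNReal.ofReal (Real.exp (-(‖ξ‖ ^ 2 / (4 * ((n : ℝ) + 1))))) * ‖charFun ν ξ‖ₑ) atTop
      (𝓝 (‖charFun ν ξ‖ₑ)) := by
    intro ξ
    have h1 : Tendsto (fun n : ℕ => (4 * ((n : ℝ) + 1))) atTop atTop :=
      (tendsto_atTop_add_const_right _ _ tendsto_natCast_atTop_atTop).const_mul_atTop (by norm_num)
    have h2 : Tendsto (fun n : ℕ => Real.exp (-(‖ξ‖ ^ 2 / (4 * ((n : ℝ) + 1))))) atTop (𝓝 1) := by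
      have := (Real.continuous_exp.tendsto _).comp (h1.const_div_atTop (‖ξ‖ ^ 2)).neg
      simpa [Function.comp_def] using this
    have h3 := ENNReal.Tendsto.mul_const (b := ‖charFun ν ξ‖ₑ)
      (ENNReal.tendsto_ofReal h2) (Or.inl (by simp))
    simpa using h3
  calc ∫⁻ ξ, ‖charFun ν ξ‖ₑ = ∫⁻ ξ : EuclideanSpace ℝ (Fin d), liminf (fun n : ℕ =>
      ENNReal.ofReal (Real.exp (-(‖ξ‖ ^ 2 / (4 * ((n : ℝ) + 1))))) * ‖charFun ν ξ‖ₑ) atTop :=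
        lintegral_congr fun ξ => (hlim ξ).liminf_eq.symm
    _ ≤ liminf (fun n : ℕ => ∫⁻ ξ : EuclideanSpace ℝ (Fin d),
      ENNReal.ofReal (Real.exp (-(‖ξ‖ ^ 2 / (4 * ((n : ℝ) + 1))))) * ‖charFun ν ξ‖ₑ) atTop := by
        refine lintegral_liminf_le fun n => ?_
        have := (measurable_charFun (μ := ν)).enorm
        fun_prop
    _ ≤ _ := by
        refine liminf_le_of_le (by isBoundedDefault) fun b hb => ?_
        obtain ⟨n, hn⟩ := hb.exists
        exact hn.trans (key _ (by positivity))

lemma conv_H {d : ℕ} (hd : 1 ≤ d) (s : ℝ) (hs2 : s < 2) (hsd : 2 - (d : ℝ) ≤ s) :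
    ∃ I : ℝ, 0 ≤ I ∧ ∀ (g : EuclideanSpace ℝ (Fin d) → ℝ) (B : ℝ), GoodDens d g B → 0 ≤ B →
    ∫⁻ ξ : EuclideanSpace ℝ (Fin d), ENNReal.ofReal (‖ξ‖ ^ (2 - s - d)) *
      ‖charFun ((dens d g) ∗ (dens d g)) ξ‖ₑ ≤ ENNReal.ofReal (I + B * (2 * Real.pi) ^ d) := by
  have hi := aux_ball d hd (2 - s - d) (by linarith)
  refine ⟨∫ ξ in Metric.ball (0 : EuclideanSpace ℝ (Fin d)) 1, ‖ξ‖ ^ (2 - s - d),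
    integral_nonneg fun ξ => by positivity, fun g B hg hB => ?_⟩
  have := dens_prob hg
  set ν := (dens d g) ∗ (dens d g) with hν
  rw [ENNReal.ofReal_add (integral_nonneg fun ξ => by positivity) (by positivity),
    ofReal_integral_eq_lintegral_ofReal hi (Eventually.of_forall fun ξ => by positivity),
    ← lintegral_indicator measurableSet_ball]
  refine le_trans ?_ (add_le_add_right (conv_char_lint hg hB) _)
  rw [← lintegral_add_left (Measurable.indicator (by fun_prop) measurableSet_ball)]
  refine lintegral_mono fun ξ => ?_
  by_cases h : ξ ∈ Metric.ball (0 : EuclideanSpace ℝ (Fin d)) 1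
  · rw [Set.indicator_of_mem h]
    refine le_trans ?_ le_self_add
    refine mul_le_of_le_one_right' ?_
    rw [← ofReal_norm, ← ENNReal.ofReal_one]
    exact ENNReal.ofReal_le_ofReal (norm_charFun_le_one _)
  · refine le_trans ?_ le_add_self
    refine mul_le_of_le_one_left' ?_
    rw [mem_ball_zero_iff, not_lt] at h
    rw [← ENNReal.ofReal_one]
    exact ENNReal.ofReal_le_ofReal (Real.rpow_le_one_of_one_le_of_nonpos h (by linarith))

lemma aux_sq {d : ℕ} (u v : EuclideanSpace ℝ (Fin d)) (a b : ℝ) (hab : a + b = 1) :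
    a * ‖u‖ ^ 2 + b * ‖v‖ ^ 2 - ‖a • u + b • v‖ ^ 2 = a * b * ‖u - v‖ ^ 2 := by
  have hb : b = 1 - a := by linarith
  rw [norm_add_sq_real, norm_sub_sq_real, norm_smul, norm_smul, inner_smul_left, inner_smul_right,
    mul_pow, mul_pow, Real.norm_eq_abs, Real.norm_eq_abs, sq_abs, sq_abs]
  simp only [conj_trivial]
  rw [hb]; ring

lemma pow_defect {d : ℕ} (hd : 1 ≤ d) (s : ℝ) (hs0 : s ≠ 0) (hs2 : s ≤ 2)
    (hsd : 2 - (d : ℝ) ≤ s) : ∃ C : ℝ, 0 < C ∧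
    ∀ (g : EuclideanSpace ℝ (Fin d) → ℝ) (B : ℝ), GoodDens d g B → 0 ≤ B →
    (∀ x, Integrable (fun w => ‖x - w‖ ^ s) ((dens d g) ∗ (dens d g))) ∧
    ∀ (x y : EuclideanSpace ℝ (Fin d)) (a b : ℝ), 0 ≤ a → 0 ≤ b → a + b = 1 →
    |a * (∫ w, ‖x - w‖ ^ s ∂((dens d g) ∗ (dens d g)))
      + b * (∫ w, ‖y - w‖ ^ s ∂((dens d g) ∗ (dens d g)))
      - ∫ w, ‖(a • x + b • y) - w‖ ^ s ∂((dens d g) ∗ (dens d g))|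
      ≤ C * (1 + B) * (a * b) * ‖x - y‖ ^ 2 := by
  have hIntg : ∀ (g : EuclideanSpace ℝ (Fin d) → ℝ) (B : ℝ), GoodDens d g B →
      ∀ x, Integrable (fun w => ‖x - w‖ ^ s) ((dens d g) ∗ (dens d g)) := by
    intro g B hg x
    rcases lt_or_gt_of_ne hs0 with h | h
    · exact conv_int_neg hd hg s h (by linarith) x
    · exact conv_int_pos hg s h hs2 x
  rcases lt_or_eq_of_le hs2 with hs | hs
  · obtain ⟨C, hC, hmain⟩ := aux_main d s hs0 hs (by linarith)
    obtain ⟨I, hI, hH⟩ := conv_H hd s hs hsd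
    refine ⟨C * (I + (2 * Real.pi) ^ d), by positivity, fun g B hg hB => ⟨hIntg g B hg, ?_⟩⟩
    intro x y a b ha hb hab
    have := dens_prob hg
    refine (hmain _ inferInstance (hIntg g B hg) (conv_ne hd hg) _ (by positivity)
      (hH g B hg hB) x y a b ha hb hab).trans ?_
    have h2 : I + B * (2 * Real.pi) ^ d ≤ (I + (2 * Real.pi) ^ d) * (1 + B) := by
      have : 0 ≤ I * B + (2 * Real.pi) ^ d := by positivity
      linarith
    have h3 : 0 ≤ a * b := mul_nonneg ha hb
    rw [mul_assoc C (I + (2 * Real.pi) ^ d) (1 + B)]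
    gcongr
  · refine ⟨1, one_pos, fun g B hg hB => ⟨hIntg g B hg, ?_⟩⟩
    intro x y a b ha hb hab
    have := dens_prob hg
    have i := hIntg g B hg
    have hi2 : Integrable (fun w => a * ‖x - w‖ ^ s + b * ‖y - w‖ ^ s) ((dens d g) ∗ (dens d g)) :=
      ((i x).const_mul a).add ((i y).const_mul b)
    rw [← integral_const_mul, ← integral_const_mul, ← integral_add ((i x).const_mul _)
      ((i y).const_mul _), ← integral_sub hi2 (i _)]
    have e : ∀ w, a * ‖x - w‖ ^ s + b * ‖y - w‖ ^ s - ‖(a • x + b • y) - w‖ ^ s =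
        a * b * ‖x - y‖ ^ 2 := by
      intro w
      have h1 := aux_sq (x - w) (y - w) a b hab
      have h2 : a • (x - w) + b • (y - w) = (a • x + b • y) - w := by
        have : w = (a + b) • w := by rw [hab, one_smul]
        conv_rhs => rw [this]
        module
      rw [h2, sub_sub_sub_cancel_right] at h1
      rw [hs, Real.rpow_two, Real.rpow_two, Real.rpow_two]
      exact h1
    have h3 : 0 ≤ a * b * ‖x - y‖ ^ 2 := by positivity
    simp_rw [e]
    rw [integral_const]
    simp only [probReal_univ, one_smul]
    rw [abs_of_nonneg h3]
    nlinarith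

lemma kreg_eq {d : ℕ} (p q : ℝ) (φ : EuclideanSpace ℝ (Fin d) → ℝ) (ε B : ℝ)
    (hg : GoodDens d (scaled d φ ε) B) (x : EuclideanSpace ℝ (Fin d))
    (hp : Integrable (fun w => ‖x - w‖ ^ p) ((dens d (scaled d φ ε)) ∗ (dens d (scaled d φ ε))))
    (hq : Integrable (fun w => ‖x - w‖ ^ q) ((dens d (scaled d φ ε)) ∗ (dens d (scaled d φ ε)))) :
    Kreg d p q φ ε x =
      (∫ w, ‖x - w‖ ^ q ∂((dens d (scaled d φ ε)) ∗ (dens d (scaled d φ ε)))) / q -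
      (∫ w, ‖x - w‖ ^ p ∂((dens d (scaled d φ ε)) ∗ (dens d (scaled d φ ε)))) / p := by
  have := dens_prob hg
  have hK : Integrable (fun w => ‖x - w‖ ^ q / q - ‖x - w‖ ^ p / p)
      ((dens d (scaled d φ ε)) ∗ (dens d (scaled d φ ε))) := (hq.div_const q).sub (hp.div_const p)
  rw [← integral_div, ← integral_div, ← integral_sub (hq.div_const q) (hp.div_const p),
    integral_conv hK, dens_integral hg, Kreg]
  refine integral_congr_ae (Eventually.of_forall fun y => ?_)
  dsimp only
  rw [dens_integral hg, smul_eq_mul, ← integral_const_mul]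
  refine integral_congr_ae (Eventually.of_forall fun z => ?_)
  simp only [Kfun, smul_eq_mul, sub_sub]
  ring

lemma moll_bdd {d : ℕ} {φ : EuclideanSpace ℝ (Fin d) → ℝ} (hφ : IsMollifier d φ) :
    ∃ M : ℝ, 0 < M ∧ ∀ x, φ x ≤ M := by
  obtain ⟨h1, h2, h3, h4, C, hC, l, hl, h5⟩ := hφ
  obtain ⟨M, hM⟩ := (isCompact_closedBall (0 : EuclideanSpace ℝ (Fin d)) 1).bddAbove_image
    h1.continuous.continuousOn
  refine ⟨max M C, lt_max_of_lt_right hC, fun x => ?_⟩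
  rcases le_or_gt ‖x‖ 1 with h | h
  · exact (hM ⟨x, by simpa using h, rfl⟩).trans (le_max_left _ _)
  · have hx : x ≠ 0 := by rintro rfl; simp at h; linarith
    refine (h5 x hx).trans (le_trans ?_ (le_max_right _ _))
    have hl4 : 4 ≤ l := (le_max_right _ _).trans hl
    exact mul_le_of_le_one_right hC.le (Real.rpow_le_one_of_one_le_of_nonpos h.le (by linarith))

lemma moll_mom {d : ℕ} (hd : 3 ≤ d) {φ : EuclideanSpace ℝ (Fin d) → ℝ} (hφ : IsMollifier d φ) :
    Integrable (fun x => φ x * ‖x‖ ^ 2) := by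
  obtain ⟨M, hM, hφM⟩ := moll_bdd hφ
  obtain ⟨h1, h2, h3, h4, C, hC, l, hl, h5⟩ := hφ
  have hd' : (3 : ℝ) ≤ d := by exact_mod_cast hd
  have hl' : 2 * (d : ℝ) + 1 ≤ l := (le_max_left _ _).trans hl
  have hb := (integrable_one_add_norm (μ := (volume : Measure (EuclideanSpace ℝ (Fin d))))
    (r := d + 1) (by simp)).const_mul ((M + C) * 2 ^ ((d : ℝ) + 1))
  have hc := h1.continuous
  refine hb.mono' (by fun_prop) (Eventually.of_forall fun x => ?_)
  rw [Real.norm_of_nonneg (mul_nonneg (h3 x) (by positivity))]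
  rcases le_or_gt ‖x‖ 1 with h | h
  · have e1 : φ x * ‖x‖ ^ 2 ≤ M := by
      have : ‖x‖ ^ 2 ≤ 1 := pow_le_one₀ (norm_nonneg _) h
      nlinarith [h3 x, hφM x, sq_nonneg ‖x‖]
    have e2 : 1 ≤ 2 ^ ((d : ℝ) + 1) * (1 + ‖x‖) ^ (-((d : ℝ) + 1)) := by
      rw [Real.rpow_neg (by positivity), ← div_eq_mul_inv, one_le_div (by positivity)]
      exact Real.rpow_le_rpow (by positivity) (by linarith) (by positivity)
    rw [mul_assoc]
    nlinarith
  · have hx : x ≠ 0 := by rintro rfl; simp at h; linarith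
    have hx0 : 0 < ‖x‖ := by linarith
    have e1 : φ x * ‖x‖ ^ 2 ≤ C * ‖x‖ ^ (-((d : ℝ) + 1)) := by
      calc φ x * ‖x‖ ^ 2 ≤ C * ‖x‖ ^ (-l) * ‖x‖ ^ 2 := by gcongr; exact h5 x hx
        _ = C * ‖x‖ ^ (-l + 2) := by
          rw [mul_assoc, ← Real.rpow_natCast, ← Real.rpow_add hx0]; norm_num
        _ ≤ _ := by
          gcongr
          · exact h.le
          · linarith
    have e2 : ‖x‖ ^ (-((d : ℝ) + 1)) ≤ 2 ^ ((d : ℝ) + 1) * (1 + ‖x‖) ^ (-((d : ℝ) + 1)) := by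
      rw [Real.rpow_neg hx0.le, Real.rpow_neg (by positivity), ← div_eq_mul_inv,
        le_div_iff₀ (by positivity), inv_mul_le_iff₀ (by positivity), mul_comm,
        ← Real.mul_rpow (by positivity) (by positivity)]
      exact Real.rpow_le_rpow (by positivity) (by linarith) (by positivity)
    have e3 : 0 ≤ 2 ^ ((d : ℝ) + 1) * (1 + ‖x‖) ^ (-((d : ℝ) + 1)) := by positivity
    rw [mul_assoc]
    nlinarith

lemma scaled_good {d : ℕ} (hd : 3 ≤ d) {φ : EuclideanSpace ℝ (Fin d) → ℝ} (hφ : IsMollifier d φ)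
    {M : ℝ} (hM : ∀ x, φ x ≤ M) {ε : ℝ} (hε : 0 < ε) :
    GoodDens d (scaled d φ ε) ((ε ^ d)⁻¹ * M) := by
  have hmom := moll_mom hd hφ
  obtain ⟨h1, h2, h3, h4, -⟩ := hφ
  have hIntg : Integrable φ := by
    by_contra h
    rw [integral_undef h] at h4
    norm_num at h4
  have hc := h1.continuous
  have hε' : ε⁻¹ ≠ 0 := inv_ne_zero hε.ne'
  constructor
  · unfold scaled; fun_prop
  · intro x; exact mul_nonneg (by positivity) (h3 _)
  · intro x; exact mul_le_mul_of_nonneg_left (hM _) (by positivity)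
  · intro x; unfold scaled; rw [h2 (ε⁻¹ • -x) (ε⁻¹ • x) (by rw [smul_neg, norm_neg])]
  · exact (hIntg.comp_smul hε').const_mul _
  · unfold scaled
    rw [integral_const_mul, Measure.integral_comp_inv_smul volume φ ε, h4, finrank_euclideanSpace,
      Fintype.card_fin, abs_of_pos (by positivity)]
    simp only [smul_eq_mul, mul_one]
    exact inv_mul_cancel₀ (by positivity)
  · refine ((hmom.comp_smul hε').const_mul ((ε ^ d)⁻¹ * ε ^ 2)).congr
      (Eventually.of_forall fun x => ?_)
    simp only [scaled]
    rw [norm_smul, Real.norm_of_nonneg (by positivity)]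
    field_simp

lemma convex_of_defect {d : ℕ} (f : EuclideanSpace ℝ (Fin d) → ℝ) (c : ℝ)
    (h : ∀ (x y : EuclideanSpace ℝ (Fin d)) (a b : ℝ), 0 ≤ a → 0 ≤ b → a + b = 1 →
      f (a • x + b • y) ≤ a * f x + b * f y + c / 2 * (a * b * ‖x - y‖ ^ 2)) :
    ConvexOn ℝ Set.univ (fun x => f x + c / 2 * ‖x‖ ^ 2) := by
  refine ⟨convex_univ, fun x _ y _ a b ha hb hab => ?_⟩
  have h1 := h x y a b ha hb hab
  rw [← aux_sq x y a b hab] at h1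
  simp only [smul_eq_mul]
  linarith

/-- `λ_ε`-convexity of `K_ε` and `-K_ε`, with `λ_ε = -C_φ ε^{-d}`. -/
theorem regularized_kernel_lambda_convex
    (d : ℕ) (hd : 3 ≤ d) (p q : ℝ) (hp1 : 2 - (d : ℝ) ≤ p) (hp2 : p < 0)
    (hq1 : 0 < q) (hq2 : q ≤ 2)
    (φ : EuclideanSpace ℝ (Fin d) → ℝ) (hφ : IsMollifier d φ) :
    ∃ Cφ : ℝ, 0 < Cφ ∧ ∃ ε₀ : ℝ, 0 < ε₀ ∧ ∀ ε : ℝ, 0 < ε → ε < ε₀ →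
      ConvexOn ℝ Set.univ
        (fun x : EuclideanSpace ℝ (Fin d) => Kreg d p q φ ε x + Cφ * (ε ^ d)⁻¹ / 2 * ‖x‖ ^ 2) ∧
      ConvexOn ℝ Set.univ
        (fun x : EuclideanSpace ℝ (Fin d) => -Kreg d p q φ ε x + Cφ * (ε ^ d)⁻¹ / 2 * ‖x‖ ^ 2) := by
  have hd1 : 1 ≤ d := by omega
  have hd' : (3 : ℝ) ≤ d := by exact_mod_cast hd
  obtain ⟨M, hM, hφM⟩ := moll_bdd hφ
  obtain ⟨Cp, hCp, hP⟩ := pow_defect hd1 p hp2.ne (by linarith) hp1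
  obtain ⟨Cq, hCq, hQ⟩ := pow_defect hd1 q hq1.ne' hq2 (by linarith)
  have hp0 : 0 < -p := by linarith
  refine ⟨2 * ((Cq / q + Cp / (-p)) * (1 + M)), by positivity, 1, one_pos, fun ε hε hε1 => ?_⟩
  have hg := scaled_good hd hφ hφM hε
  set B := (ε ^ d)⁻¹ * M with hB
  have hB0 : 0 ≤ B := by positivity
  obtain ⟨ip, dp⟩ := hP _ B hg hB0
  obtain ⟨iq, dq⟩ := hQ _ B hg hB0
  have h1B : 1 + B ≤ (1 + M) * (ε ^ d)⁻¹ := by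
    have : 1 ≤ (ε ^ d)⁻¹ := (one_le_inv₀ (by positivity)).2 (pow_le_one₀ hε.le hε1.le)
    rw [hB]; linarith
  have key : ∀ (x y : EuclideanSpace ℝ (Fin d)) (a b : ℝ), 0 ≤ a → 0 ≤ b → a + b = 1 →
      |a * Kreg d p q φ ε x + b * Kreg d p q φ ε y - Kreg d p q φ ε (a • x + b • y)| ≤
      2 * ((Cq / q + Cp / (-p)) * (1 + M)) * (ε ^ d)⁻¹ / 2 * (a * b * ‖x - y‖ ^ 2) := by
    intro x y a b ha hb hab
    have e := fun x => kreg_eq p q φ ε B hg x (ip x) (iq x)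
    rw [e, e, e]
    have d1 := dp x y a b ha hb hab
    have d2 := dq x y a b ha hb hab
    generalize (∫ w, ‖x - w‖ ^ q ∂((dens d (scaled d φ ε)) ∗ (dens d (scaled d φ ε)))) = q1 at *
    generalize (∫ w, ‖y - w‖ ^ q ∂((dens d (scaled d φ ε)) ∗ (dens d (scaled d φ ε)))) = q2 at *
    generalize (∫ w, ‖(a • x + b • y) - w‖ ^ q
      ∂((dens d (scaled d φ ε)) ∗ (dens d (scaled d φ ε)))) = q3 at *
    generalize (∫ w, ‖x - w‖ ^ p ∂((dens d (scaled d φ ε)) ∗ (dens d (scaled d φ ε)))) = p1 at *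
    generalize (∫ w, ‖y - w‖ ^ p ∂((dens d (scaled d φ ε)) ∗ (dens d (scaled d φ ε)))) = p2 at *
    generalize (∫ w, ‖(a • x + b • y) - w‖ ^ p
      ∂((dens d (scaled d φ ε)) ∗ (dens d (scaled d φ ε)))) = p3 at *
    have h3 : 0 ≤ a * b * ‖x - y‖ ^ 2 := by positivity
    have e1 : a * (q1 / q - p1 / p) + b * (q2 / q - p2 / p) - (q3 / q - p3 / p) =
        (a * q1 + b * q2 - q3) / q + (a * p1 + b * p2 - p3) / (-p) := by
      rw [div_neg]; ring
    rw [e1]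
    calc _ ≤ |(a * q1 + b * q2 - q3) / q| + |(a * p1 + b * p2 - p3) / (-p)| := abs_add_le _ _
      _ = |a * q1 + b * q2 - q3| / q + |a * p1 + b * p2 - p3| / (-p) := by
        rw [abs_div, abs_div, abs_of_pos hq1, abs_of_pos hp0]
      _ ≤ (Cq * (1 + B) * (a * b) * ‖x - y‖ ^ 2) / q
          + (Cp * (1 + B) * (a * b) * ‖x - y‖ ^ 2) / (-p) := by gcongr
      _ = ((Cq / q + Cp / (-p)) * (a * b * ‖x - y‖ ^ 2)) * (1 + B) := by ring
      _ ≤ ((Cq / q + Cp / (-p)) * (a * b * ‖x - y‖ ^ 2)) * ((1 + M) * (ε ^ d)⁻¹) := by gcongr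
      _ = _ := by ring
  constructor
  · refine convex_of_defect _ _ fun x y a b ha hb hab => ?_
    have := (abs_le.1 (key x y a b ha hb hab)).1
    linarith
  · refine convex_of_defect (fun x => -Kreg d p q φ ε x) _ fun x y a b ha hb hab => ?_
    have := (abs_le.1 (key x y a b ha hb hab)).2
    linarith
end
end

section
/- For every μ ∈ P_2(ℝ^d) there exist a constant C > 0 (depending on the mollifier φ and on μ) and ε₀ > 0 such that for all 0 < ε < ε₀, the metric local slope of the regularized energy satisfies 2 ‖(∇K_ε)*μ‖_{L²(μ)} ≤ C ε^{1−d}, i.e., 4 ∫_{ℝ^d} |∫_{ℝ^d} ∇K_ε(x−y) dμ(y)|² dμ(x) ≤ C² ε^{2(1−d)}. -/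
open MeasureTheory Filter
open scoped ENNReal Topology NNReal

noncomputable section

lemma aux_rpow_lip {a r t : ℝ} (hr : 0 < r) (ht : 0 < t) :
    |r ^ a - t ^ a| ≤ |a| * (r ^ (a - 1) + t ^ (a - 1)) * |r - t| := by
  wlog h : t ≤ r generalizing r t
  · have := this ht hr (le_of_not_ge h)
    rw [abs_sub_comm, abs_sub_comm r t, add_comm]; exact this
  have key := (convex_Icc t r).norm_image_sub_le_of_norm_hasDerivWithin_le
    (f := fun x : ℝ => x ^ a) (f' := fun x => a * x ^ (a - 1))
    (C := |a| * (r ^ (a - 1) + t ^ (a - 1))) (x := t) (y := r)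
    (fun x hx => by
      have hx0 : x ≠ 0 := (ht.trans_le hx.1).ne'
      exact (Real.hasDerivAt_rpow_const (Or.inl hx0)).hasDerivWithinAt)
    (fun x hx => by
      have hx0 : 0 < x := ht.trans_le hx.1
      rw [Real.norm_eq_abs, abs_mul, abs_of_nonneg (Real.rpow_nonneg hx0.le _)]
      refine mul_le_mul_of_nonneg_left ?_ (abs_nonneg _)
      rcases le_total 0 (a - 1) with h0 | h0
      · have := Real.rpow_le_rpow hx0.le hx.2 h0
        have := Real.rpow_nonneg ht.le (a - 1)
        linarith
      · have := Real.rpow_le_rpow_of_nonpos ht hx.1 h0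
        have := Real.rpow_nonneg hr.le (a - 1)
        linarith)
    (Set.left_mem_Icc.2 h) (Set.right_mem_Icc.2 h)
  simpa [Real.norm_eq_abs] using key

lemma aux_rpow_le {r a b c : ℝ} (hr : 0 < r) (hba : b ≤ a) (hac : a ≤ c) :
    r ^ a ≤ r ^ b + r ^ c := by
  have h1 := Real.rpow_nonneg hr.le b
  have h2 := Real.rpow_nonneg hr.le c
  rcases le_total r 1 with h | h
  · have := Real.rpow_le_rpow_of_exponent_ge hr h hba
    linarith
  · have := Real.rpow_le_rpow_of_exponent_le h hac
    linarith

lemma aux_K_lip {d : ℕ} (hd : 3 ≤ d) {p q : ℝ} (hp1 : 2 - (d : ℝ) ≤ p) (hp2 : p < 0)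
    (hq1 : 0 < q) (hq2 : q ≤ 2) {a b : EuclideanSpace ℝ (Fin d)} (ha : a ≠ 0) (hb : b ≠ 0) :
    |Kfun d p q a - Kfun d p q b| ≤
      ((2 * ‖a‖ ^ (1 - (d : ℝ)) + 1 + ‖a‖) + (2 * ‖b‖ ^ (1 - (d : ℝ)) + 1 + ‖b‖)) * ‖a - b‖ := by
  have hd' : (3 : ℝ) ≤ d := by exact_mod_cast hd
  have ha' := norm_pos_iff.2 ha
  have hb' := norm_pos_iff.2 hb
  have h1 := aux_rpow_lip (a := q) ha' hb'
  have h2 := aux_rpow_lip (a := p) ha' hb'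
  have h3 := abs_norm_sub_norm_le a b
  have e : ∀ r : ℝ, 0 < r → r ^ (q - 1) + r ^ (p - 1) ≤ 2 * r ^ (1 - (d : ℝ)) + 1 + r := by
    intro r hr
    have := aux_rpow_le (a := q - 1) (b := 1 - (d : ℝ)) (c := 1) hr (by linarith) (by linarith)
    have := aux_rpow_le (a := p - 1) (b := 1 - (d : ℝ)) (c := 0) hr (by linarith) (by linarith)
    simp only [Real.rpow_one, Real.rpow_zero] at *
    linarith
  have ea := e _ ha'
  have eb := e _ hb'
  rw [abs_of_pos hq1] at h1
  rw [abs_of_neg hp2] at h2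
  have g1 : |‖a‖ ^ q / q - ‖b‖ ^ q / q| ≤ (‖a‖ ^ (q - 1) + ‖b‖ ^ (q - 1)) * |‖a‖ - ‖b‖| := by
    rw [← sub_div, abs_div, abs_of_pos hq1, div_le_iff₀ hq1]
    linarith
  have g2 : |‖a‖ ^ p / p - ‖b‖ ^ p / p| ≤ (‖a‖ ^ (p - 1) + ‖b‖ ^ (p - 1)) * |‖a‖ - ‖b‖| := by
    rw [← sub_div, abs_div, abs_of_neg hp2, div_le_iff₀ (by linarith)]
    linarith
  have : Kfun d p q a - Kfun d p q b
      = (‖a‖ ^ q / q - ‖b‖ ^ q / q) - (‖a‖ ^ p / p - ‖b‖ ^ p / p) := by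
    unfold Kfun; ring
  rw [this]
  refine (abs_sub _ _).trans ?_
  refine (add_le_add g1 g2).trans ?_
  rw [← add_mul]
  refine mul_le_mul ?_ h3 (abs_nonneg _) (by positivity)
  linarith

lemma aux_K_bd {d : ℕ} (hd : 3 ≤ d) {p q : ℝ} (hp1 : 2 - (d : ℝ) ≤ p) (hp2 : p < 0)
    (hq1 : 0 < q) (hq2 : q ≤ 2) {a : EuclideanSpace ℝ (Fin d)} (ha : a ≠ 0) :
    |Kfun d p q a| ≤ (1 / q + 1 / (-p)) * (‖a‖ ^ (1 - (d : ℝ)) + 1 + ‖a‖ ^ 2) := by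
  have hd' : (3 : ℝ) ≤ d := by exact_mod_cast hd
  have ha' := norm_pos_iff.2 ha
  have h1 := aux_rpow_le (a := q) (b := 0) (c := 2) ha' (by linarith) (by linarith)
  have h2 := aux_rpow_le (a := p) (b := 1 - (d : ℝ)) (c := 0) ha' (by linarith) (by linarith)
  rw [Real.rpow_zero] at h1 h2
  rw [Real.rpow_two] at h1
  have h3 := Real.rpow_nonneg ha'.le (1 - (d : ℝ))
  have h5 : 0 < 1 / (-p) := by apply one_div_pos.2; linarith
  have h6 : 0 < 1 / q := by positivity
  have : Kfun d p q a = 1 / q * ‖a‖ ^ q + 1 / (-p) * ‖a‖ ^ p := by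
    unfold Kfun; field_simp; ring
  rw [this, abs_of_nonneg (by positivity), add_mul]
  gcongr <;> nlinarith [sq_nonneg ‖a‖]

lemma aux_K_meas (d : ℕ) (p q : ℝ) : Measurable (Kfun d p q) := by
  unfold Kfun
  fun_prop

lemma aux_sing {d : ℕ} (hd : 3 ≤ d) {m : Measure (EuclideanSpace ℝ (Fin d))} {A : ℝ}
    (hA0 : 0 ≤ A) (hA : ∀ w, ∫⁻ u, ‖w - u‖ₑ ^ (1 - (d : ℝ)) ∂m ≤ ENNReal.ofReal A)
    {ε : ℝ} (hε : 0 < ε) (x : EuclideanSpace ℝ (Fin d)) :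
    (∀ᵐ u ∂m, x - ε • u ≠ 0) ∧ Integrable (fun u => ‖x - ε • u‖ ^ (1 - (d : ℝ))) m ∧
      ∫ u, ‖x - ε • u‖ ^ (1 - (d : ℝ)) ∂m ≤ ε ^ (1 - (d : ℝ)) * A := by
  have hd' : (3 : ℝ) ≤ d := by exact_mod_cast hd
  have hs : 1 - (d : ℝ) < 0 := by linarith
  set s := 1 - (d : ℝ) with hsdef
  have hx : ∀ u, x - ε • u = ε • (ε⁻¹ • x - u) := by
    intro u; rw [smul_sub, smul_inv_smul₀ hε.ne']
  have hm : Measurable (fun u : EuclideanSpace ℝ (Fin d) => ‖ε⁻¹ • x - u‖ₑ ^ s) := by fun_prop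
  have hfin : ∫⁻ u, ‖ε⁻¹ • x - u‖ₑ ^ s ∂m ≠ ⊤ :=
    ((hA (ε⁻¹ • x)).trans_lt ENNReal.ofReal_lt_top).ne
  have hae : ∀ᵐ u ∂m, ε⁻¹ • x - u ≠ 0 := by
    filter_upwards [ae_lt_top hm hfin] with u hu h0
    rw [h0, enorm_zero, ENNReal.zero_rpow_of_neg hs] at hu
    exact lt_irrefl _ hu
  have hae' : ∀ᵐ u ∂m, ENNReal.ofReal (‖ε⁻¹ • x - u‖ ^ s) = ‖ε⁻¹ • x - u‖ₑ ^ s := by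
    filter_upwards [hae] with u hu
    rw [← ENNReal.ofReal_rpow_of_pos (norm_pos_iff.2 hu), ofReal_norm]
  have hl : ∫⁻ u, ENNReal.ofReal (‖ε⁻¹ • x - u‖ ^ s) ∂m ≤ ENNReal.ofReal A := by
    rw [lintegral_congr_ae hae']; exact hA _
  have hmr : Measurable (fun u : EuclideanSpace ℝ (Fin d) => ‖ε⁻¹ • x - u‖ ^ s) := by fun_prop
  have hnn : ∀ u : EuclideanSpace ℝ (Fin d), 0 ≤ ‖ε⁻¹ • x - u‖ ^ s :=
    fun u => Real.rpow_nonneg (norm_nonneg _) _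
  have hint : Integrable (fun u => ‖ε⁻¹ • x - u‖ ^ s) m := by
    refine ⟨hmr.aestronglyMeasurable, ?_⟩
    rw [hasFiniteIntegral_iff_ofReal (Eventually.of_forall hnn)]
    exact hl.trans_lt ENNReal.ofReal_lt_top
  have hval : ∫ u, ‖ε⁻¹ • x - u‖ ^ s ∂m ≤ A := by
    rw [integral_eq_lintegral_of_nonneg_ae (Eventually.of_forall hnn) hmr.aestronglyMeasurable]
    exact ENNReal.toReal_le_of_le_ofReal hA0 hl
  have heq : (fun u => ‖x - ε • u‖ ^ s) = fun u => ε ^ s * ‖ε⁻¹ • x - u‖ ^ s := by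
    funext u
    rw [hx, norm_smul, Real.norm_of_nonneg hε.le, Real.mul_rpow hε.le (norm_nonneg _)]
  refine ⟨?_, ?_, ?_⟩
  · filter_upwards [hae] with u hu
    rw [hx]; exact smul_ne_zero hε.ne' hu
  · rw [heq]; exact hint.const_mul _
  · rw [heq, integral_const_mul]
    exact mul_le_mul_of_nonneg_left hval (Real.rpow_nonneg hε.le _)

lemma aux_norm_int {d : ℕ} {m : Measure (EuclideanSpace ℝ (Fin d))} [IsProbabilityMeasure m]
    (h2 : Integrable (fun u => ‖u‖ ^ 2) m) : Integrable (fun u => ‖u‖) m := by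
  refine Integrable.mono' ((integrable_const (1 : ℝ)).add h2) (by fun_prop)
    (Eventually.of_forall fun u => ?_)
  simp only [Pi.add_apply, norm_norm]
  nlinarith [sq_nonneg (‖u‖ - 1), norm_nonneg u]

lemma aux_K_int {d : ℕ} (hd : 3 ≤ d) {p q : ℝ} (hp1 : 2 - (d : ℝ) ≤ p) (hp2 : p < 0)
    (hq1 : 0 < q) (hq2 : q ≤ 2) {m : Measure (EuclideanSpace ℝ (Fin d))}
    [IsProbabilityMeasure m] (h2 : Integrable (fun u => ‖u‖ ^ 2) m) {A : ℝ}
    (hA0 : 0 ≤ A) (hA : ∀ w, ∫⁻ u, ‖w - u‖ₑ ^ (1 - (d : ℝ)) ∂m ≤ ENNReal.ofReal A)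
    {ε : ℝ} (hε : 0 < ε) (x : EuclideanSpace ℝ (Fin d)) :
    Integrable (fun u => Kfun d p q (x - ε • u)) m := by
  obtain ⟨h0, h1, -⟩ := aux_sing hd hA0 hA hε x
  have h3 : Integrable (fun u => ‖x - ε • u‖ ^ 2) m := by
    refine Integrable.mono' ((integrable_const (2 * ‖x‖ ^ 2)).add (h2.const_mul (2 * ε ^ 2)))
      (by fun_prop) (Eventually.of_forall fun u => ?_)
    have e1 := norm_sub_le x (ε • u)
    rw [norm_smul, Real.norm_of_nonneg hε.le] at e1
    simp only [Pi.add_apply]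
    rw [Real.norm_of_nonneg (by positivity)]
    have := pow_le_pow_left₀ (norm_nonneg _) e1 2
    nlinarith [sq_nonneg (‖x‖ - ε * ‖u‖)]
  refine Integrable.mono' (((h1.add (integrable_const 1)).add h3).const_mul (1 / q + 1 / (-p)))
    ((aux_K_meas d p q).comp (by fun_prop)).aestronglyMeasurable ?_
  filter_upwards [h0] with u hu
  exact aux_K_bd hd hp1 hp2 hq1 hq2 hu

lemma aux_F_lip {d : ℕ} (hd : 3 ≤ d) {p q : ℝ} (hp1 : 2 - (d : ℝ) ≤ p) (hp2 : p < 0)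
    (hq1 : 0 < q) (hq2 : q ≤ 2) {m : Measure (EuclideanSpace ℝ (Fin d))}
    [IsProbabilityMeasure m] (h2 : Integrable (fun u => ‖u‖ ^ 2) m) {A : ℝ}
    (hA0 : 0 ≤ A) (hA : ∀ w, ∫⁻ u, ‖w - u‖ₑ ^ (1 - (d : ℝ)) ∂m ≤ ENNReal.ofReal A)
    {ε : ℝ} (hε : 0 < ε) (hε1 : ε < 1) (x x' : EuclideanSpace ℝ (Fin d)) :
    |∫ u, Kfun d p q (x - ε • u) ∂m - ∫ u, Kfun d p q (x' - ε • u) ∂m| ≤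
      (4 * (ε ^ (1 - (d : ℝ)) * A) + 2 + ‖x‖ + ‖x'‖ + 2 * ∫ u, ‖u‖ ∂m) * ‖x - x'‖ := by
  have hn := aux_norm_int h2
  have hN : ∀ x : EuclideanSpace ℝ (Fin d), Integrable (fun u => ‖x - ε • u‖) m ∧
      ∫ u, ‖x - ε • u‖ ∂m ≤ ‖x‖ + ∫ u, ‖u‖ ∂m := by
    intro x
    have hb : ∀ u, ‖x - ε • u‖ ≤ ‖x‖ + ‖u‖ := by
      intro u
      refine (norm_sub_le x (ε • u)).trans ?_
      rw [norm_smul, Real.norm_of_nonneg hε.le]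
      nlinarith [norm_nonneg u]
    have hi : Integrable (fun u => ‖x - ε • u‖) m := by
      refine Integrable.mono' ((integrable_const ‖x‖).add hn) (by fun_prop)
        (Eventually.of_forall fun u => ?_)
      rw [norm_norm]; exact hb u
    refine ⟨hi, ?_⟩
    calc ∫ u, ‖x - ε • u‖ ∂m ≤ ∫ u, (‖x‖ + ‖u‖) ∂m :=
          integral_mono hi ((integrable_const ‖x‖).add hn) hb
      _ = _ := by rw [integral_add (integrable_const _) hn]; simp
  have hG : ∀ x : EuclideanSpace ℝ (Fin d),
      Integrable (fun u => 2 * ‖x - ε • u‖ ^ (1 - (d : ℝ)) + 1 + ‖x - ε • u‖) m ∧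
      ∫ u, (2 * ‖x - ε • u‖ ^ (1 - (d : ℝ)) + 1 + ‖x - ε • u‖) ∂m ≤
        2 * (ε ^ (1 - (d : ℝ)) * A) + 1 + ‖x‖ + ∫ u, ‖u‖ ∂m := by
    intro x
    obtain ⟨-, h1, h1'⟩ := aux_sing hd hA0 hA hε x
    obtain ⟨h3, h3'⟩ := hN x
    have h4 : Integrable (fun u => 2 * ‖x - ε • u‖ ^ (1 - (d : ℝ)) + 1) m :=
      (h1.const_mul 2).add (integrable_const 1)
    refine ⟨h4.add h3, ?_⟩
    rw [integral_add h4 h3,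
      integral_add (h1.const_mul 2) (integrable_const 1), integral_const_mul]
    simp only [integral_const, probReal_univ, smul_eq_mul, mul_one]
    linarith
  rw [← integral_sub (aux_K_int hd hp1 hp2 hq1 hq2 h2 hA0 hA hε x)
    (aux_K_int hd hp1 hp2 hq1 hq2 h2 hA0 hA hε x'), ← Real.norm_eq_abs]
  refine (norm_integral_le_of_norm_le (((hG x).1.add (hG x').1).mul_const ‖x - x'‖) ?_).trans ?_
  · filter_upwards [(aux_sing hd hA0 hA hε x).1, (aux_sing hd hA0 hA hε x').1] with u hu hu'
    have := aux_K_lip hd hp1 hp2 hq1 hq2 hu hu'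
    rw [sub_sub_sub_cancel_right] at this
    exact this
  · rw [integral_mul_const]
    simp only [Pi.add_apply]
    rw [integral_add (hG x).1 (hG x').1]
    refine mul_le_mul_of_nonneg_right ?_ (norm_nonneg _)
    linarith [(hG x).2, (hG x').2]

lemma aux_phi_bdd {d : ℕ} {φ : EuclideanSpace ℝ (Fin d) → ℝ} (hφ : IsMollifier d φ) :
    ∃ B : ℝ, 0 < B ∧ ∀ x, φ x ≤ B ∧ φ x ≤ B * (1 + ‖x‖) ^ (-(2 * (d : ℝ) + 1)) := by
  obtain ⟨hc, -, h0, -, C, hC, l, hl, hdec⟩ := hφ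
  obtain ⟨B0, hB0⟩ := (isCompact_closedBall (0 : EuclideanSpace ℝ (Fin d)) 1).bddAbove_image
    hc.continuous.continuousOn
  have hl1 : 2 * (d : ℝ) + 1 ≤ l := (le_max_left _ _).trans hl
  set k : ℝ := 2 * (d : ℝ) + 1 with hk
  have hk0 : 0 < k := by positivity
  have hb : ∀ x, φ x ≤ max C B0 * 2 ^ k * (1 + ‖x‖) ^ (-k) := by
    intro x
    have hx1 : 0 < 1 + ‖x‖ := by positivity
    rw [Real.rpow_neg hx1.le, ← div_eq_mul_inv, le_div_iff₀ (Real.rpow_pos_of_pos hx1 _)]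
    rcases le_total ‖x‖ 1 with h | h
    · have h1 : φ x ≤ B0 := hB0 ⟨x, by simpa using h, rfl⟩
      have h2 : (1 + ‖x‖) ^ k ≤ 2 ^ k := Real.rpow_le_rpow hx1.le (by linarith) hk0.le
      exact mul_le_mul (h1.trans (le_max_right _ _)) h2 (by positivity) (hC.le.trans (le_max_left _ _))
    · have hx0 : 0 < ‖x‖ := by linarith
      have h1 := hdec x (norm_pos_iff.1 hx0)
      have h2 : ‖x‖ ^ (-l) ≤ ‖x‖ ^ (-k) := Real.rpow_le_rpow_of_exponent_le h (by linarith)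
      have h3 : (1 + ‖x‖) ^ k ≤ (2 * ‖x‖) ^ k := Real.rpow_le_rpow hx1.le (by linarith) hk0.le
      rw [Real.mul_rpow (by norm_num) hx0.le] at h3
      have h4 : ‖x‖ ^ (-k) * ‖x‖ ^ k = 1 := by
        rw [← Real.rpow_add hx0]; simp
      calc φ x * (1 + ‖x‖) ^ k ≤ (C * ‖x‖ ^ (-k)) * (2 ^ k * ‖x‖ ^ k) :=
            mul_le_mul (h1.trans (by gcongr)) h3 (by positivity) (by positivity)
        _ = C * 2 ^ k * (‖x‖ ^ (-k) * ‖x‖ ^ k) := by ring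
        _ ≤ _ := by rw [h4, mul_one]; gcongr; exact le_max_left _ _
  have hM : 0 < max C B0 * 2 ^ k := mul_pos (hC.trans_le (le_max_left _ _)) (by positivity)
  refine ⟨_, hM, fun x => ⟨(hb x).trans ?_, hb x⟩⟩
  refine mul_le_of_le_one_right hM.le ?_
  exact Real.rpow_le_one_of_one_le_of_nonpos (by linarith [norm_nonneg x]) (by linarith)

/-- The law with density `φ`. -/
def nuM (d : ℕ) (φ : EuclideanSpace ℝ (Fin d) → ℝ) : Measure (EuclideanSpace ℝ (Fin d)) :=
  volume.withDensity fun x => ENNReal.ofReal (φ x)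

lemma aux_nu_int {d : ℕ} {φ : EuclideanSpace ℝ (Fin d) → ℝ} (hφ : IsMollifier d φ)
    (g : EuclideanSpace ℝ (Fin d) → ℝ) : ∫ z, g z ∂(nuM d φ) = ∫ z, φ z * g z := by
  unfold nuM
  rw [integral_withDensity_eq_integral_toReal_smul (by have := hφ.1.continuous; fun_prop) (by simp)]
  refine integral_congr_ae (Eventually.of_forall fun z => ?_)
  simp [ENNReal.toReal_ofReal (hφ.2.2.1 z)]

lemma aux_nu_prob {d : ℕ} {φ : EuclideanSpace ℝ (Fin d) → ℝ} (hφ : IsMollifier d φ) :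
    IsProbabilityMeasure (nuM d φ) := by
  refine ⟨?_⟩
  have hi : Integrable φ := by
    by_contra h
    have := hφ.2.2.2.1
    rw [integral_undef h] at this
    norm_num at this
  unfold nuM
  rw [withDensity_apply _ MeasurableSet.univ, Measure.restrict_univ,
    ← ofReal_integral_eq_lintegral_ofReal hi (Eventually.of_forall hφ.2.2.1), hφ.2.2.2.1]
  simp

lemma aux_nu_mom {d : ℕ} (hd : 3 ≤ d) {φ : EuclideanSpace ℝ (Fin d) → ℝ} (hφ : IsMollifier d φ) :
    Integrable (fun u => ‖u‖ ^ 2) (nuM d φ) := by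
  have hd' : (3 : ℝ) ≤ d := by exact_mod_cast hd
  obtain ⟨B, hB, hb⟩ := aux_phi_bdd hφ
  have hc := hφ.1.continuous
  unfold nuM
  rw [integrable_withDensity_iff (by fun_prop) (by simp)]
  have hJ := integrable_one_add_norm (E := EuclideanSpace ℝ (Fin d)) (μ := volume)
    (r := 2 * (d : ℝ) - 1) (by simp; linarith)
  refine Integrable.mono' (hJ.const_mul B)
    (Continuous.aestronglyMeasurable (by
      simp only [ENNReal.toReal_ofReal (hφ.2.2.1 _)]; fun_prop)) (Eventually.of_forall fun u => ?_)
  rw [ENNReal.toReal_ofReal (hφ.2.2.1 _),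
    Real.norm_of_nonneg (mul_nonneg (by positivity) (hφ.2.2.1 _))]
  have hx1 : 0 < 1 + ‖u‖ := by positivity
  calc ‖u‖ ^ 2 * φ u ≤ (1 + ‖u‖) ^ 2 * (B * (1 + ‖u‖) ^ (-(2 * (d : ℝ) + 1))) :=
        mul_le_mul (by gcongr; linarith) (hb u).2 (hφ.2.2.1 _) (by positivity)
    _ = B * (1 + ‖u‖) ^ (-(2 * (d : ℝ) - 1)) := by
        rw [mul_left_comm, ← Real.rpow_two, ← Real.rpow_add hx1]
        congr 2; ring

lemma aux_ball_s4 {d : ℕ} (hd : 3 ≤ d) :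
    ∫⁻ x in Metric.ball (0 : EuclideanSpace ℝ (Fin d)) 1, ‖x‖ₑ ^ (1 - (d : ℝ)) < ⊤ := by
  have hd' : (3 : ℝ) ≤ d := by exact_mod_cast hd
  have h := integrableOn_ball_of_norm_le_rpow (μ := (volume : Measure (EuclideanSpace ℝ (Fin d))))
    (by simp; omega) (f := fun x => ‖x‖ ^ (1 - (d : ℝ))) (C := 1) (α := (d : ℝ) - 1) (r := 1)
    (by simp) (Eventually.of_forall fun x => by
      rw [Real.norm_of_nonneg (by positivity)]; simp) (Measurable.aestronglyMeasurable (by fun_prop))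
  have h2 := h.2
  rw [hasFiniteIntegral_iff_ofReal (Eventually.of_forall fun x => by positivity)] at h2
  refine lt_of_eq_of_lt (lintegral_congr_ae ?_) h2
  have : Nontrivial (EuclideanSpace ℝ (Fin d)) :=
    Module.nontrivial_of_finrank_pos (R := ℝ) (by simp; omega)
  refine ae_restrict_of_ae ?_
  have : ∀ᵐ x : EuclideanSpace ℝ (Fin d), x ≠ 0 := by
    simp [ae_iff]
  filter_upwards [this] with u hu
  rw [← ENNReal.ofReal_rpow_of_pos (norm_pos_iff.2 hu), ofReal_norm]

lemma aux_nu_sing {d : ℕ} (hd : 3 ≤ d) {φ : EuclideanSpace ℝ (Fin d) → ℝ} (hφ : IsMollifier d φ) :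
    ∃ A : ℝ, 0 ≤ A ∧ ∀ w, ∫⁻ u, ‖w - u‖ₑ ^ (1 - (d : ℝ)) ∂(nuM d φ) ≤ ENNReal.ofReal A := by
  have hd' : (3 : ℝ) ≤ d := by exact_mod_cast hd
  obtain ⟨B, hB, hb⟩ := aux_phi_bdd hφ
  have hc := hφ.1.continuous
  have hball := aux_ball_s4 hd
  have := aux_nu_prob hφ
  set J := ∫⁻ x in Metric.ball (0 : EuclideanSpace ℝ (Fin d)) 1, ‖x‖ₑ ^ (1 - (d : ℝ)) with hJ
  refine ⟨(ENNReal.ofReal B * J + 1).toReal, ENNReal.toReal_nonneg, fun w => ?_⟩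
  rw [ENNReal.ofReal_toReal (by finiteness)]
  have hφm : Measurable fun x => ENNReal.ofReal (φ x) := by fun_prop
  have hmass : ∫⁻ u, ENNReal.ofReal (φ u) = 1 := by
    have := this.measure_univ
    unfold nuM at this
    rwa [withDensity_apply _ MeasurableSet.univ, Measure.restrict_univ] at this
  set F : EuclideanSpace ℝ (Fin d) → ℝ≥0∞ :=
    (Metric.ball (0 : EuclideanSpace ℝ (Fin d)) 1).indicator (fun x => ‖x‖ₑ ^ (1 - (d : ℝ))) with hF
  have hFm : Measurable F := Measurable.indicator (by fun_prop) measurableSet_ball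
  unfold nuM
  rw [lintegral_withDensity_eq_lintegral_mul _ hφm (by fun_prop)]
  calc ∫⁻ u, ((fun x => ENNReal.ofReal (φ x)) * fun u => ‖w - u‖ₑ ^ (1 - (d : ℝ))) u
      ≤ ∫⁻ u, (ENNReal.ofReal B * F (w - u) + ENNReal.ofReal (φ u)) := by
        refine lintegral_mono fun u => ?_
        simp only [Pi.mul_apply]
        by_cases h : w - u ∈ Metric.ball (0 : EuclideanSpace ℝ (Fin d)) 1
        · rw [hF, Set.indicator_of_mem h]
          refine le_add_right ?_
          gcongr
          exact (hb u).1
        · refine le_add_left ?_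
          refine mul_le_of_le_one_right' ?_
          have h1 : 1 ≤ ‖w - u‖ₑ := by
            rw [← ofReal_norm, ENNReal.one_le_ofReal]
            simpa using h
          exact ENNReal.rpow_le_one_of_one_le_of_neg h1 (by linarith)
    _ = ENNReal.ofReal B * J + 1 := by
        rw [lintegral_add_right _ hφm, hmass, lintegral_const_mul _ (by fun_prop),
          lintegral_sub_left_eq_self F w, hF, lintegral_indicator measurableSet_ball]

lemma aux_conv {d : ℕ} (hd : 3 ≤ d) {φ : EuclideanSpace ℝ (Fin d) → ℝ} (hφ : IsMollifier d φ) :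
    IsProbabilityMeasure (nuM d φ ∗ nuM d φ) ∧
    Integrable (fun u => ‖u‖ ^ 2) (nuM d φ ∗ nuM d φ) ∧
    ∃ A : ℝ, 0 ≤ A ∧ ∀ w, ∫⁻ u, ‖w - u‖ₑ ^ (1 - (d : ℝ)) ∂(nuM d φ ∗ nuM d φ)
      ≤ ENNReal.ofReal A := by
  have hprob := aux_nu_prob hφ
  have h2 := aux_nu_mom hd hφ
  refine ⟨inferInstance, ?_, ?_⟩
  · unfold Measure.conv
    rw [integrable_map_measure (by fun_prop) (by fun_prop)]
    refine Integrable.mono' (((h2.comp_fst (nuM d φ)).add (h2.comp_snd (nuM d φ))).const_mul 2)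
      (by fun_prop) (Eventually.of_forall fun z => ?_)
    simp only [Function.comp_apply, Pi.add_apply]
    rw [Real.norm_of_nonneg (by positivity)]
    have := pow_le_pow_left₀ (norm_nonneg _) (norm_add_le z.1 z.2) 2
    nlinarith [sq_nonneg (‖z.1‖ - ‖z.2‖)]
  · obtain ⟨A, hA0, hA⟩ := aux_nu_sing hd hφ
    refine ⟨A, hA0, fun w => ?_⟩
    rw [Measure.lintegral_conv (by fun_prop)]
    calc _ ≤ ∫⁻ _, ENNReal.ofReal A ∂(nuM d φ) := by
          refine lintegral_mono fun y => ?_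
          simp only [← sub_sub]
          exact hA (w - y)
      _ = _ := by simp

lemma aux_scaled {d : ℕ} {φ : EuclideanSpace ℝ (Fin d) → ℝ} (hφ : IsMollifier d φ)
    {ε : ℝ} (hε : 0 < ε) (g : EuclideanSpace ℝ (Fin d) → ℝ) :
    ∫ z, scaled d φ ε z * g z = ∫ z, g (ε • z) ∂(nuM d φ) := by
  rw [aux_nu_int hφ]
  have := Measure.integral_comp_inv_smul_of_nonneg
    (volume : Measure (EuclideanSpace ℝ (Fin d))) (fun z => φ z * g (ε • z)) hε.le
  simp only [smul_inv_smul₀ hε.ne', finrank_euclideanSpace, Fintype.card_fin, smul_eq_mul] at this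
  unfold scaled
  simp only [mul_assoc]
  rw [integral_const_mul, this, inv_mul_cancel_left₀ (by positivity)]

lemma aux_Kreg {d : ℕ} (hd : 3 ≤ d) {p q : ℝ} (hp1 : 2 - (d : ℝ) ≤ p) (hp2 : p < 0)
    (hq1 : 0 < q) (hq2 : q ≤ 2) {φ : EuclideanSpace ℝ (Fin d) → ℝ} (hφ : IsMollifier d φ)
    {ε : ℝ} (hε : 0 < ε) (x : EuclideanSpace ℝ (Fin d)) :
    Kreg d p q φ ε x = ∫ u, Kfun d p q (x - ε • u) ∂(nuM d φ ∗ nuM d φ) := by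
  obtain ⟨hP, h2, A, hA0, hA⟩ := aux_conv hd hφ
  have hprob := aux_nu_prob hφ
  rw [integral_conv (aux_K_int hd hp1 hp2 hq1 hq2 h2 hA0 hA hε x)]
  unfold Kreg
  simp only [mul_assoc, integral_const_mul]
  rw [aux_scaled hφ hε (fun y => ∫ z, Kfun d p q (x - y - z) * scaled d φ ε z)]
  simp only [mul_comm (Kfun _ _ _ _)]
  refine integral_congr_ae (Eventually.of_forall fun y => ?_)
  simp only
  rw [aux_scaled hφ hε (fun z => Kfun d p q (x - ε • y - z))]
  simp only [smul_add, sub_sub]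

lemma aux_grad {d : ℕ} (hd : 3 ≤ d) {p q : ℝ} (hp1 : 2 - (d : ℝ) ≤ p) (hp2 : p < 0)
    (hq1 : 0 < q) (hq2 : q ≤ 2) {φ : EuclideanSpace ℝ (Fin d) → ℝ} (hφ : IsMollifier d φ) :
    ∃ D : ℝ, 0 < D ∧ ∀ ε : ℝ, 0 < ε → ε < 1 → ∀ x,
      ‖gradient (Kreg d p q φ ε) x‖ ≤ D * ε ^ (1 - (d : ℝ)) * (1 + ‖x‖) := by
  have hd' : (3 : ℝ) ≤ d := by exact_mod_cast hd
  obtain ⟨hP, h2, A, hA0, hA⟩ := aux_conv hd hφ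
  set M := ∫ u, ‖u‖ ∂(nuM d φ ∗ nuM d φ) with hM
  have hM0 : 0 ≤ M := integral_nonneg fun u => norm_nonneg u
  refine ⟨4 * A + 3 + 2 * M, by positivity, fun ε hε hε1 x => ?_⟩
  have he : 1 ≤ ε ^ (1 - (d : ℝ)) :=
    Real.one_le_rpow_of_pos_of_le_one_of_nonpos hε hε1.le (by linarith)
  set e := ε ^ (1 - (d : ℝ)) with hedef
  unfold gradient
  rw [LinearIsometryEquiv.norm_map]
  refine norm_fderiv_le_of_lip' ℝ (by positivity) ?_
  filter_upwards [Metric.ball_mem_nhds x one_pos] with x' hx'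
  rw [aux_Kreg hd hp1 hp2 hq1 hq2 hφ hε, aux_Kreg hd hp1 hp2 hq1 hq2 hφ hε, Real.norm_eq_abs]
  refine (aux_F_lip hd hp1 hp2 hq1 hq2 h2 hA0 hA hε hε1 x' x).trans ?_
  refine mul_le_mul_of_nonneg_right ?_ (norm_nonneg _)
  rw [mem_ball_iff_norm] at hx'
  have h3 : ‖x'‖ ≤ ‖x‖ + 1 := by
    have := norm_sub_norm_le x' x
    linarith
  have hx0 := norm_nonneg x
  rw [← hM, ← hedef]
  have k1 : e * A ≤ e * A * (1 + ‖x‖) := le_mul_of_one_le_right (by positivity) (by linarith)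
  have k2 : 1 + ‖x‖ ≤ e * (1 + ‖x‖) := le_mul_of_one_le_left (by linarith) he
  have k3 : M ≤ e * (1 + ‖x‖) * M := le_mul_of_one_le_left hM0 (by nlinarith)
  nlinarith
/-- Bound on the metric local slope of the regularized energy:
`2‖(∇K_ε)*μ‖_{L²(μ)} ≤ C ε^{1-d}`. -/
theorem metric_slope_regularized_energy_bound
    (d : ℕ) (hd : 3 ≤ d) (p q : ℝ) (hp1 : 2 - (d : ℝ) ≤ p) (hp2 : p < 0)
    (hq1 : 0 < q) (hq2 : q ≤ 2)
    (φ : EuclideanSpace ℝ (Fin d) → ℝ) (hφ : IsMollifier d φ)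
    (μ : Measure (EuclideanSpace ℝ (Fin d))) (hμ : IsP2 d μ) :
    ∃ C : ℝ, 0 < C ∧ ∃ ε₀ : ℝ, 0 < ε₀ ∧ ∀ ε : ℝ, 0 < ε → ε < ε₀ →
      4 * ∫ x, ‖∫ y, gradient (Kreg d p q φ ε) (x - y) ∂μ‖ ^ 2 ∂μ
        ≤ C ^ 2 * ε ^ (2 * (1 - (d : ℝ))) := by
  obtain ⟨D, hD, hgrad⟩ := aux_grad hd hp1 hp2 hq1 hq2 hφ
  obtain ⟨hprob, hmom⟩ := hμ
  have h2 : Integrable (fun u => ‖u‖ ^ 2) μ := by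
    refine ⟨by fun_prop, ?_⟩
    rw [hasFiniteIntegral_iff_enorm]
    simpa [enorm_pow, enorm_eq_nnnorm] using hmom
  have h1 := aux_norm_int h2
  set M := ∫ u, ‖u‖ ∂μ with hM
  have hM0 : 0 ≤ M := integral_nonneg fun u => norm_nonneg u
  have hI : Integrable (fun x => (1 + M + ‖x‖) ^ 2) μ := by
    have : (fun x : EuclideanSpace ℝ (Fin d) => (1 + M + ‖x‖) ^ 2) =
        fun x => (1 + M) ^ 2 + 2 * (1 + M) * ‖x‖ + ‖x‖ ^ 2 := by funext x; ring
    rw [this]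
    exact ((integrable_const _).add (h1.const_mul _)).add h2
  set I := ∫ x, (1 + M + ‖x‖) ^ 2 ∂μ with hIdef
  have hI0 : 0 ≤ I := integral_nonneg fun u => by positivity
  refine ⟨2 * D * (I + 1), by positivity, 1, one_pos, fun ε hε hε1 => ?_⟩
  have hε0 : 0 < ε ^ (1 - (d : ℝ)) := Real.rpow_pos_of_pos hε _
  have hpow : ε ^ (2 * (1 - (d : ℝ))) = (ε ^ (1 - (d : ℝ))) ^ 2 := by
    rw [mul_comm, Real.rpow_mul hε.le, Real.rpow_two]
  set e := ε ^ (1 - (d : ℝ)) with he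
  have hin : ∀ x, ‖∫ y, gradient (Kreg d p q φ ε) (x - y) ∂μ‖ ≤ D * e * (1 + M + ‖x‖) := by
    intro x
    have hi : Integrable (fun y => D * e * (1 + ‖x‖ + ‖y‖)) μ :=
      ((integrable_const _).add h1).const_mul _
    refine (norm_integral_le_of_norm_le hi (Eventually.of_forall fun y => ?_)).trans ?_
    · refine (hgrad ε hε hε1 (x - y)).trans ?_
      refine mul_le_mul_of_nonneg_left ?_ (by positivity)
      linarith [norm_sub_le x y]
    · rw [integral_const_mul, integral_add (integrable_const _) h1]
      simp only [integral_const, probReal_univ, one_smul]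
      rw [← hM]
      apply le_of_eq; ring
  have hout : ∫ x, ‖∫ y, gradient (Kreg d p q φ ε) (x - y) ∂μ‖ ^ 2 ∂μ ≤ (D * e) ^ 2 * I := by
    rw [hIdef, ← integral_const_mul]
    refine integral_mono_of_nonneg (Eventually.of_forall fun x => by positivity)
      (hI.const_mul _) (Eventually.of_forall fun x => ?_)
    simp only
    rw [← mul_pow]
    exact pow_le_pow_left₀ (norm_nonneg _) (hin x) 2
  rw [hpow]
  have : (D * e) ^ 2 * I ≤ (D * e) ^ 2 * (I + 1) ^ 2 :=
    mul_le_mul_of_nonneg_left (by nlinarith) (by positivity)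
  calc _ ≤ 4 * ((D * e) ^ 2 * (I + 1) ^ 2) := by linarith
    _ = _ := by ring
end
end
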